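/- In the lattice Coulomb gas on an N×N torus Λ (N ≥ 4) at inverse temperature β* ≤ 1/12, the variance of the voltage U_{ij}(k) = ∑_ℓ (G_{iℓ} − G_{jℓ})k_ℓ satisfies (4/β*)(G_{ii} − G_{ij}) − (4/(β*)²)·M_{(4β*)^{−1}} ≤ Var*_{Λ,β*}(U_{ij}) = E*_{Λ,β*}[U_{ij}²] ≤ (4/β*)(G_{ii} − G_{ij}), where M_β = 2φ(β)(1+φ(β))/(1−φ(β))³ and φ(β) = 480(3e^{−β})⁴. -/

import Mathlib

open Matrix Filter

/-- The discrete two-dimensional torus `(ℤ/Nℤ)²`. -/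
abbrev Torus (N : ℕ) := ZMod N × ZMod N

/-- The four nearest-neighbor steps on the torus. -/
def torusSteps (N : ℕ) : List (Torus N) := [(1, 0), (-1, 0), (0, 1), (0, -1)]

/-- One-step transition kernel of simple random walk on the torus:
each of the four steps is taken with probability `1/4`. -/
noncomputable def srwKernel (N : ℕ) : Matrix (Torus N) (Torus N) ℝ :=
  fun i j => ((torusSteps N).count (j - i) : ℝ) / 4

/-- The lattice Laplacian on the torus: `Δ_ij = 1` for neighbors `i ∼ j`
(counted with multiplicity), `Δ_ii = -4`, and `0` otherwise. -/
noncomputable def lap (N : ℕ) : Matrix (Torus N) (Torus N) ℝ :=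
  fun i j => if i = j then -4 else ((torusSteps N).count (j - i) : ℝ)

/-- The Green's function
`G_ij = lim_{λ↓0} ∑_{t≥0} (P_i(X_t = j) − 1/|Λ|) e^{−λt}` of simple random walk. -/
noncomputable def green (N : ℕ) [NeZero N] (i j : Torus N) : ℝ :=
  limUnder (nhdsWithin (0 : ℝ) (Set.Ioi 0))
    (fun lam : ℝ =>
      ∑' t : ℕ, ((srwKernel N ^ t) i j - 1 / (N ^ 2 : ℝ)) * Real.exp (-lam * t))

/-- A four-element set has at most four subsets of even size containing a given element. -/
theorem card_even_subsets_le {E : Type*} [DecidableEq E] {S : Finset E} (hS : S.card = 4) {e : E}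
    (he : e ∈ S) : (S.powerset.filter fun A => e ∈ A ∧ Even A.card).card ≤ 4 := by
  have h3 : (S.erase e).card = 3 := by rw [Finset.card_erase_of_mem he, hS]
  obtain ⟨a, b, c, hab, hac, hbc, habc⟩ := Finset.card_eq_three.1 h3
  have hSe : S = {e, a, b, c} := by rw [← habc, Finset.insert_erase he]
  have hea : e ≠ a := by
    rintro rfl
    have : e ∈ S.erase e := by rw [habc]; simp
    simp at this
  have heb : e ≠ b := by
    rintro rfl
    have : e ∈ S.erase e := by rw [habc]; simp
    simp at this
  have hec : e ≠ c := by
    rintro rfl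
    have : e ∈ S.erase e := by rw [habc]; simp
    simp at this
  have hsub : (S.powerset.filter fun A => e ∈ A ∧ Even A.card) ⊆
      {{e, a}, {e, b}, {e, c}, {e, a, b, c}} := by
    intro A hA
    simp only [Finset.mem_filter, Finset.mem_powerset] at hA
    obtain ⟨hAS, heA, hev⟩ := hA
    have hAS' : ∀ x ∈ A, x = e ∨ x = a ∨ x = b ∨ x = c := by
      intro x hx
      have := hAS hx
      rw [hSe] at this
      simpa using this
    have key : A = ({e, a, b, c} : Finset E).filter (· ∈ A) := by
      ext x
      simp only [Finset.mem_filter, Finset.mem_insert, Finset.mem_singleton]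
      exact ⟨fun h => ⟨hAS' x h, h⟩, fun h => h.2⟩
    rw [key] at hev
    by_cases ha : a ∈ A <;> by_cases hb : b ∈ A <;> by_cases hc : c ∈ A <;>
      rw [key] <;>
      simp [Finset.filter_insert, Finset.filter_singleton, heA, ha, hb, hc, hea, heb, hec, hab, hac,
        hbc] at hev ⊢ <;>
      exact absurd hev (by decide)
  refine (Finset.card_le_card hsub).trans ?_
  exact Finset.card_le_four

/-- Exploration bound: sets which meet every plaquette evenly and all of whose
plaquette-components meet a known part `K` number at most `4 ^ n`, where `n` bounds the number of
unexplored plaquettes they touch. -/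
theorem card_le_four_pow_of_explored {E P : Type*} [DecidableEq E] [DecidableEq P] [Fintype P]
    (pl : P → Finset E) (hpl : ∀ p, (pl p).card = 4) (n : ℕ) :
    ∀ (K : Finset E) (Q : Finset P) (F : Finset (Finset E)),
      (∀ Γ ∈ F, K ⊆ Γ) → (∀ Γ ∈ F, ∀ p ∈ Q, Γ ∩ pl p ⊆ K) →
      (∀ Γ ∈ F, ∀ p, Even (Γ ∩ pl p).card) →
      (∀ Γ ∈ F, ∀ γ ⊆ Γ, (∀ p, Disjoint γ (pl p) ∨ Γ ∩ pl p ⊆ γ) → Disjoint γ K → γ = ∅) →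
      (∀ Γ ∈ F, (Finset.univ.filter fun p => p ∉ Q ∧ (Γ ∩ pl p).Nonempty).card ≤ n) →
      F.card ≤ 4 ^ n := by
  induction n with
  | zero =>
    intro K Q F hK hQ hev hconn hn
    refine Finset.card_le_one.2 fun Γ hΓ Γ' hΓ' => ?_
    have : ∀ Γ ∈ F, Γ = K := by
      intro Γ hΓ
      have h0 := hn Γ hΓ
      simp only [Nat.le_zero, Finset.card_eq_zero, Finset.filter_eq_empty_iff, Finset.mem_univ,
        true_implies, not_and, Finset.not_nonempty_iff_eq_empty] at h0
      have := hconn Γ hΓ (Γ \ K) Finset.sdiff_subset (fun p => ?_) Finset.sdiff_disjoint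
      · exact Finset.Subset.antisymm (Finset.sdiff_eq_empty_iff_subset.1 this) (hK Γ hΓ)
      · left
        rw [Finset.disjoint_left]
        intro x hx hxp
        rw [Finset.mem_sdiff] at hx
        by_cases hp : p ∈ Q
        · exact hx.2 (hQ Γ hΓ p hp (Finset.mem_inter.2 ⟨hx.1, hxp⟩))
        · have := h0 hp
          exact Finset.notMem_empty x (this ▸ Finset.mem_inter.2 ⟨hx.1, hxp⟩)
    rw [this Γ hΓ, this Γ' hΓ']
  | succ n ih =>
    intro K Q F hK hQ hev hconn hn
    by_cases hp : ∃ p ∉ Q, (K ∩ pl p).Nonempty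
    · obtain ⟨p, hpQ, e, he⟩ := hp
      rw [Finset.mem_inter] at he
      have h4 := card_even_subsets_le (hpl p) he.2
      have := Finset.card_le_mul_card_image_of_maps_to (s := F) (f := fun Γ => Γ ∩ pl p)
        (t := (pl p).powerset.filter fun A => e ∈ A ∧ Even A.card) (fun Γ hΓ => by
          simp only [Finset.mem_filter, Finset.mem_powerset]
          exact ⟨Finset.inter_subset_right, Finset.mem_inter.2 ⟨hK Γ hΓ he.1, he.2⟩, hev Γ hΓ p⟩)
        (4 ^ n) (fun A hA => by
          refine ih (K ∪ A) (insert p Q) _ ?_ ?_ ?_ ?_ ?_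
          · intro Γ hΓ
            rw [Finset.mem_filter] at hΓ
            exact Finset.union_subset (hK Γ hΓ.1) (hΓ.2 ▸ Finset.inter_subset_left)
          · intro Γ hΓ q hq
            rw [Finset.mem_filter] at hΓ
            rcases Finset.mem_insert.1 hq with rfl | hq
            · rw [hΓ.2]; exact Finset.subset_union_right
            · exact (hQ Γ hΓ.1 q hq).trans Finset.subset_union_left
          · intro Γ hΓ
            exact hev Γ (Finset.mem_filter.1 hΓ).1
          · intro Γ hΓ γ hγ hs hd
            exact hconn Γ (Finset.mem_filter.1 hΓ).1 γ hγ hs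
              (Finset.disjoint_of_subset_right Finset.subset_union_left hd)
          · intro Γ hΓ
            have hΓF := (Finset.mem_filter.1 hΓ).1
            have h1 := hn Γ hΓF
            rw [← Nat.lt_succ_iff]
            refine lt_of_lt_of_le (Finset.card_lt_card ?_) h1
            rw [Finset.ssubset_iff_of_subset]
            · refine ⟨p, ?_, by simp⟩
              simp only [Finset.mem_filter, Finset.mem_univ, true_and]
              exact ⟨hpQ, e, Finset.mem_inter.2 ⟨hK Γ hΓF he.1, he.2⟩⟩
            · intro q
              simp only [Finset.mem_filter, Finset.mem_univ, true_and, Finset.mem_insert, not_or]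
              tauto)
      calc F.card ≤ 4 ^ n * _ := this
        _ ≤ 4 ^ n * 4 := by gcongr
        _ = 4 ^ (n + 1) := (pow_succ _ _).symm
    · push Not at hp
      have : ∀ Γ ∈ F, Γ = K := by
        intro Γ hΓ
        have := hconn Γ hΓ (Γ \ K) Finset.sdiff_subset (fun p => ?_) Finset.sdiff_disjoint
        · exact Finset.Subset.antisymm (Finset.sdiff_eq_empty_iff_subset.1 this) (hK Γ hΓ)
        · by_cases hpQ : p ∈ Q
          · left
            rw [Finset.disjoint_left]
            intro x hx hxp
            rw [Finset.mem_sdiff] at hx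
            exact hx.2 (hQ Γ hΓ p hpQ (Finset.mem_inter.2 ⟨hx.1, hxp⟩))
          · right
            intro x hx
            rw [Finset.mem_inter] at hx
            refine Finset.mem_sdiff.2 ⟨hx.1, fun hxK => ?_⟩
            exact Finset.notMem_empty x (hp p hpQ ▸ Finset.mem_inter.2 ⟨hxK, hx.2⟩)
      have h1 : F.card ≤ 1 := Finset.card_le_one.2 fun Γ hΓ Γ' hΓ' => by
        rw [this Γ hΓ, this Γ' hΓ']
      exact h1.trans (Nat.one_le_pow _ _ (by norm_num))

/-- If every edge lies in at most two plaquettes, a set meeting every plaquette evenly touches at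
most as many plaquettes as it has edges. -/
theorem card_touched_le {E P : Type*} [DecidableEq E] [Fintype P] [DecidableEq P]
    (pl : P → Finset E) (h2 : ∀ e, (Finset.univ.filter fun p => e ∈ pl p).card ≤ 2)
    (Γ : Finset E) (hev : ∀ p, Even (Γ ∩ pl p).card) :
    (Finset.univ.filter fun p => (Γ ∩ pl p).Nonempty).card ≤ Γ.card := by
  have := Finset.card_mul_le_card_mul (fun (p : P) (e : E) => e ∈ pl p)
    (s := Finset.univ.filter fun p => (Γ ∩ pl p).Nonempty) (t := Γ) (m := 2) (n := 2)
    (fun p hp => ?_) (fun e _ => ?_)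
  · omega
  · have hne := (Finset.mem_filter.1 hp).2
    have : Finset.bipartiteAbove (fun (p : P) (e : E) => e ∈ pl p) Γ p = Γ ∩ pl p := by
      ext; simp [Finset.bipartiteAbove]
    rw [this]
    obtain ⟨k, hk⟩ := hev p
    have := hne.card_pos
    omega
  · refine (Finset.card_le_card ?_).trans (h2 e)
    intro p
    simp only [Finset.bipartiteBelow, Finset.mem_filter, Finset.mem_univ, true_and]
    tauto

/-- The edges of the torus: `(v, false)` joins `v` to `v + (1, 0)` and `(v, true)` joins `v` to
`v + (0, 1)`. -/
abbrev TorusEdge (N : ℕ) := Torus N × Bool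

/-- The unit step in the direction of an edge. -/
def edgeStep (N : ℕ) : Bool → Torus N
  | false => (1, 0)
  | true => (0, 1)

/-- The discrete gradient of a function on the torus. -/
def grad {N : ℕ} {R : Type*} [Sub R] (f : Torus N → R) (e : TorusEdge N) : R :=
  f (e.1 + edgeStep N e.2) - f e.1

/-- The integer-valued indicator function of a set of vertices. -/
def ind {N : ℕ} (D : Finset (Torus N)) (v : Torus N) : ℤ := if v ∈ D then 1 else 0

/-- The edge boundary of a set of vertices. -/
def bd {N : ℕ} [NeZero N] (D : Finset (Torus N)) : Finset (TorusEdge N) :=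
  Finset.univ.filter fun e => grad (ind D) e ≠ 0

/-- A set whose boundary has no proper part that is itself an oriented boundary. -/
def IsIrredCut {N : ℕ} (D : Finset (Torus N)) : Prop :=
  ∀ f : Torus N → ℤ, (∀ e, grad f e = 0 ∨ grad f e = grad (ind D) e) →
    (∀ e, grad f e = 0) ∨ ∀ e, grad f e = grad (ind D) e

theorem mem_bd {N : ℕ} [NeZero N] {D : Finset (Torus N)} {e : TorusEdge N} :
    e ∈ bd D ↔ grad (ind D) e ≠ 0 := by
  simp [bd]

theorem grad_ind_cases {N : ℕ} (D : Finset (Torus N)) (e : TorusEdge N) :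
    grad (ind D) e = 0 ∨ grad (ind D) e = 1 ∨ grad (ind D) e = -1 := by
  unfold grad ind
  split_ifs <;> simp

/-- A function is constant along a path of repeated steps on which its gradient vanishes. -/
theorem eq_add_nsmul_of_grad_eq_zero {N : ℕ} {f : Torus N → ℤ} {b : Bool} {v : Torus N} {n : ℕ}
    (h : ∀ k < n, grad f (v + k • edgeStep N b, b) = 0) : f (v + n • edgeStep N b) = f v := by
  induction n with
  | zero => simp
  | succ n ih =>
    have h1 := h n (Nat.lt_succ_self n)
    rw [← ih fun k hk => h k (hk.trans (Nat.lt_succ_self n))]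
    unfold grad at h1
    rw [succ_nsmul, ← add_assoc]
    simpa using sub_eq_zero.1 h1

/-- The torus is connected: a function with vanishing gradient is constant. -/
theorem eq_of_grad_eq_zero {N : ℕ} [NeZero N] {R : Type*} [AddGroup R] {f : Torus N → R}
    (h : ∀ e, grad f e = 0) (u v : Torus N) : f u = f v := by
  have step : ∀ (b : Bool) (v : Torus N) (n : ℕ), f (v + n • edgeStep N b) = f v := by
    intro b v n
    induction n with
    | zero => simp
    | succ n ih =>
      rw [← ih, succ_nsmul, ← add_assoc]
      exact sub_eq_zero.1 (h (v + n • edgeStep N b, b))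
  have : u = v + (u.1 - v.1).val • edgeStep N false + (u.2 - v.2).val • edgeStep N true := by
    ext <;> simp [edgeStep]
  rw [this, step, step]

/-- Peierls extraction: if `x j < x i`, some irreducible set separates `i` from `j` and `x`
decreases outwards across its whole boundary. -/
theorem exists_isIrredCut {N : ℕ} [NeZero N] {x : Torus N → ℤ} {i j : Torus N} (hx : x j < x i) :
    ∃ D : Finset (Torus N), i ∈ D ∧ j ∉ D ∧ IsIrredCut D ∧
      ∀ e, grad (ind D) e ≠ 0 → 1 ≤ grad (ind D) e * grad x e := by
  classical
  let S : Finset (Finset (Torus N)) := Finset.univ.filter fun D => i ∈ D ∧ j ∉ D ∧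
    ∀ e, grad (ind D) e ≠ 0 → 1 ≤ grad (ind D) e * grad x e
  have level : ∀ (f : Torus N → ℤ) (c : ℤ) (e : TorusEdge N),
      grad (ind (Finset.univ.filter fun v => c < f v)) e ≠ 0 →
      (grad (ind (Finset.univ.filter fun v => c < f v)) e = 1 ∧ 1 ≤ grad f e) ∨
      (grad (ind (Finset.univ.filter fun v => c < f v)) e = -1 ∧ grad f e ≤ -1) := by
    intro f c e he
    unfold grad ind at *
    simp only [Finset.mem_filter, Finset.mem_univ, true_and] at *
    split_ifs at * <;> simp_all <;> omega
  have hS : S.Nonempty := by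
    refine ⟨Finset.univ.filter fun v => x j < x v, ?_⟩
    simp only [S, Finset.mem_filter, Finset.mem_univ, true_and]
    refine ⟨hx, lt_irrefl _, fun e he => ?_⟩
    rcases level x (x j) e he with ⟨h1, h2⟩ | ⟨h1, h2⟩ <;> rw [h1] <;> omega
  obtain ⟨D, hD, hmin⟩ := Finset.exists_min_image S (fun D => (bd D).card) hS
  obtain ⟨hi, hj, hsgn⟩ := (Finset.mem_filter.1 hD).2
  have key : ∀ f : Torus N → ℤ, (∀ e, grad f e = 0 ∨ grad f e = grad (ind D) e) → f j < f i →
      ∀ e, grad f e = grad (ind D) e := by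
    intro f hf hij
    let D' : Finset (Torus N) := Finset.univ.filter fun v => f j < f v
    have hD' : ∀ e, grad (ind D') e ≠ 0 → grad f e ≠ 0 ∧ grad (ind D') e = grad (ind D) e := by
      intro e he
      have h1 := level f (f j) e he
      have h2 := hf e
      have h3 := grad_ind_cases D e
      change (grad (ind D') e = 1 ∧ _) ∨ (grad (ind D') e = -1 ∧ _) at h1
      omega
    have hmem : D' ∈ S := by
      simp only [S, Finset.mem_filter, Finset.mem_univ, true_and]
      refine ⟨by simpa [D'] using hij, by simp [D'], fun e he => ?_⟩
      have := (hD' e he).2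
      rw [this] at he ⊢
      exact hsgn e he
    have hsub : bd D' ⊆ bd D := by
      intro e he
      rw [mem_bd] at he ⊢
      rw [← (hD' e he).2]; exact he
    have heq := Finset.eq_of_subset_of_card_le hsub (hmin D' hmem)
    intro e
    by_cases h0 : grad (ind D) e = 0
    · rcases hf e with h | h
      · rw [h, h0]
      · exact h
    · have : e ∈ bd D' := heq ▸ mem_bd.2 h0
      exact (hf e).resolve_left (hD' e (mem_bd.1 this)).1
  refine ⟨D, hi, hj, fun f hf => ?_, hsgn⟩
  by_cases hij : f j < f i
  · exact Or.inr (key f hf hij)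
  · left
    have hg : ∀ e, grad (fun v => ind D v - f v) e = grad (ind D) e - grad f e := by
      intro e; unfold grad; ring
    have := key (fun v => ind D v - f v) (fun e => by
      rw [hg]
      rcases hf e with h | h <;> rw [h] <;> simp) (by
      have : ind D i = 1 := by simp [ind, hi]
      have : ind D j = 0 := by simp [ind, hj]
      omega)
    intro e
    have := this e
    rw [hg] at this
    omega

/-- The Dirichlet energy of an integer height function. -/
def energy {N : ℕ} [NeZero N] (x : Torus N → ℤ) : ℤ := ∑ e, grad x e ^ 2

/-- Lowering the heights by one inside a descending cut saves at least its boundary length. -/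
theorem energy_sub_ind_le {N : ℕ} [NeZero N] {x : Torus N → ℤ} {D : Finset (Torus N)}
    (h : ∀ e, grad (ind D) e ≠ 0 → 1 ≤ grad (ind D) e * grad x e) :
    energy (fun v => x v - ind D v) + (bd D).card ≤ energy x := by
  have hb : ((bd D).card : ℤ) = ∑ e, if grad (ind D) e ≠ 0 then 1 else 0 := by
    rw [bd, Finset.card_filter]; push_cast; rfl
  rw [hb, energy, energy, ← Finset.sum_add_distrib]
  refine Finset.sum_le_sum fun e _ => ?_
  have hg : grad (fun v => x v - ind D v) e = grad x e - grad (ind D) e := by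
    unfold grad; ring
  rw [hg]
  have := h e
  rcases grad_ind_cases D e with h0 | h0 | h0 <;> rw [h0] at this ⊢ <;> simp at this ⊢ <;> nlinarith

/-- The four edges around a plaquette. -/
def plaq {N : ℕ} (v : Torus N) : Finset (TorusEdge N) :=
  {(v, false), (v, true), (v + edgeStep N true, false), (v + edgeStep N false, true)}

theorem card_plaq {N : ℕ} (hN : 2 ≤ N) (v : Torus N) : (plaq v).card = 4 := by
  unfold plaq
  rw [Finset.card_insert_of_notMem, Finset.card_insert_of_notMem, Finset.card_insert_of_notMem,
    Finset.card_singleton] <;> simp [Prod.ext_iff, edgeStep] <;>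
    (have : Fact (1 < N) := ⟨hN⟩) <;> simp

theorem even_card_bd_inter_plaq {N : ℕ} [NeZero N] (hN : 2 ≤ N) (D : Finset (Torus N))
    (v : Torus N) : Even (bd D ∩ plaq v).card := by
  have h1 : bd D ∩ plaq v = (plaq v).filter fun e => grad (ind D) e ≠ 0 := by
    ext e
    rw [Finset.mem_inter, Finset.mem_filter, mem_bd, and_comm]
  rw [h1, Finset.card_filter]
  unfold plaq
  have : Fact (1 < N) := ⟨hN⟩
  rw [Finset.sum_insert (by simp [Prod.ext_iff, edgeStep]),
    Finset.sum_insert (by simp [Prod.ext_iff, edgeStep]),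
    Finset.sum_insert (by simp [Prod.ext_iff, edgeStep]), Finset.sum_singleton]
  have h2 : v + edgeStep N false + edgeStep N true = v + edgeStep N true + edgeStep N false := by
    abel
  simp only [grad, ind, h2]
  by_cases ha : v ∈ D <;> by_cases hb : v + edgeStep N true ∈ D <;>
    by_cases hc : v + edgeStep N false ∈ D <;>
    by_cases hd : v + edgeStep N true + edgeStep N false ∈ D <;> simp [ha, hb, hc, hd] <;> decide

theorem card_plaq_containing_le {N : ℕ} [NeZero N] (e : TorusEdge N) :
    (Finset.univ.filter fun v => e ∈ plaq v).card ≤ 2 := by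
  refine (Finset.card_le_card (t := {e.1, e.1 - edgeStep N (!e.2)}) ?_).trans Finset.card_le_two
  intro v
  obtain ⟨w, b⟩ := e
  cases b <;>
  · simp only [plaq, Finset.mem_filter, Finset.mem_univ, true_and, Finset.mem_insert,
      Finset.mem_singleton, Prod.mk.injEq]
    rintro (h | h | h | h) <;> simp_all

/-- A closed `1`-form on the torus which vanishes along one row and one column is exact. -/
theorem exists_grad_eq {N : ℕ} [NeZero N] (ω : TorusEdge N → ℤ)
    (hcl : ∀ v, ω (v, false) + ω (v + edgeStep N false, true) =
      ω (v, true) + ω (v + edgeStep N true, false))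
    (a₀ b₀ : ZMod N) (hrow : ∀ a, ω ((a, b₀), false) = 0) (hcol : ∀ b, ω ((a₀, b), true) = 0) :
    ∃ f : Torus N → ℤ, ∀ e, grad f e = ω e := by
  let F : ZMod N → ℕ → ℤ := fun a k => ∑ t ∈ Finset.range k, ω ((a, b₀ + (t : ZMod N)), true)
  have H : ∀ (k : ℕ) (a : ZMod N), F (a + 1) k - F a k = ω ((a, b₀ + (k : ZMod N)), false) := by
    intro k a
    induction k with
    | zero => simp [F, hrow]
    | succ k ih =>
      have := hcl (a, b₀ + (k : ZMod N))
      simp only [edgeStep, Prod.mk_add_mk, add_zero] at this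
      simp only [F, Finset.sum_range_succ] at ih ⊢
      push_cast
      rw [← add_assoc]
      linarith
  have wrap : ∀ a, F a N = 0 := by
    have h1 : ∀ n : ℕ, F (a₀ + (n : ZMod N)) N = 0 := by
      intro n
      induction n with
      | zero => simp [F, hcol]
      | succ n ih =>
        have := H N (a₀ + (n : ZMod N))
        rw [ih] at this
        push_cast
        rw [← add_assoc]
        simpa [hrow] using this
    intro a
    have := h1 (a - a₀).val
    simpa using this
  refine ⟨fun v => F v.1 (v.2 - b₀).val, ?_⟩
  rintro ⟨⟨a, b⟩, d⟩
  cases d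
  · have := H (b - b₀).val a
    simpa [grad, edgeStep] using this
  · simp only [grad, edgeStep, Prod.mk_add_mk, add_zero]
    have hc : b + 1 - b₀ = (((b - b₀).val + 1 : ℕ) : ZMod N) := by
      push_cast; rw [ZMod.natCast_zmod_val]; ring
    have hF : F a (b + 1 - b₀).val = F a ((b - b₀).val + 1) := by
      rw [hc, ZMod.val_natCast]
      have hlt := ZMod.val_lt (b - b₀)
      rcases Nat.lt_or_eq_of_le (Nat.succ_le_of_lt hlt) with h | h
      · rw [Nat.mod_eq_of_lt h]
      · simp only [Nat.succ_eq_add_one] at h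
        rw [h, wrap, Nat.mod_self]; simp [F]
    rw [hF]
    simp [F, Finset.sum_range_succ]

/-- A union of plaquette-components of the boundary of an irreducible cut, avoiding a row and a
column, is trivial. -/
theorem IsIrredCut.eq_empty_or_eq_bd {N : ℕ} [NeZero N] {D : Finset (Torus N)} (hD : IsIrredCut D)
    {γ : Finset (TorusEdge N)} (hγ : γ ⊆ bd D)
    (hs : ∀ v, Disjoint γ (plaq v) ∨ bd D ∩ plaq v ⊆ γ) {a₀ b₀ : ZMod N}
    (hrow : ∀ a, ((a, b₀), false) ∉ γ) (hcol : ∀ b, ((a₀, b), true) ∉ γ) :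
    γ = ∅ ∨ γ = bd D := by
  obtain ⟨f, hf⟩ := exists_grad_eq (fun e => if e ∈ γ then grad (ind D) e else 0) (by
    intro v
    have hmem : (v, false) ∈ plaq v ∧ (v, true) ∈ plaq v ∧ (v + edgeStep N true, false) ∈ plaq v ∧
        (v + edgeStep N false, true) ∈ plaq v := by simp [plaq]
    obtain ⟨m1, m2, m3, m4⟩ := hmem
    rcases hs v with h | h
    · have hn : ∀ e ∈ plaq v, e ∉ γ := fun e he h' => Finset.disjoint_left.1 h h' he
      simp [hn _ m1, hn _ m2, hn _ m3, hn _ m4]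
    · have hn : ∀ e ∈ plaq v, (if e ∈ γ then grad (ind D) e else 0) = grad (ind D) e := by
        intro e he
        split_ifs with h'
        · rfl
        · by_contra h0
          exact h' (h (Finset.mem_inter.2 ⟨mem_bd.2 (Ne.symm h0), he⟩))
      simp only [hn _ m1, hn _ m2, hn _ m3, hn _ m4]
      simp only [grad]
      rw [show v + edgeStep N false + edgeStep N true = v + edgeStep N true + edgeStep N false by
        abel]
      ring) a₀ b₀ (fun a => by simp [hrow a]) (fun b => by simp [hcol b])
  rcases hD f (fun e => by rw [hf]; split_ifs <;> simp) with h | h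
  · left
    refine Finset.eq_empty_of_forall_notMem fun e he => ?_
    have := hf e
    rw [if_pos he, h] at this
    exact mem_bd.1 (hγ he) this.symm
  · right
    refine Finset.Subset.antisymm hγ fun e he => ?_
    by_contra h'
    have := hf e
    rw [if_neg h', h] at this
    exact mem_bd.1 he this

/-- The coordinate labelling the line through a vertex in a given direction. -/
def lineOf {N : ℕ} (b : Bool) (v : Torus N) : ZMod N := if b then v.1 else v.2

/-- The lines in a given direction that are crossed by the boundary. -/
def hits {N : ℕ} [NeZero N] (D : Finset (Torus N)) (b : Bool) : Finset (ZMod N) :=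
  ((bd D).filter fun e => e.2 = b).image fun e => lineOf b e.1

theorem lineOf_add_nsmul {N : ℕ} (b : Bool) (v : Torus N) (n : ℕ) :
    lineOf b (v + n • edgeStep N b) = lineOf b v := by
  cases b <;> simp [lineOf, edgeStep]

theorem lineOf_not_add_nsmul {N : ℕ} (b : Bool) (v : Torus N) (n : ℕ) :
    lineOf (!b) (v + n • edgeStep N b) = lineOf (!b) v + n := by
  cases b <;> simp [lineOf, edgeStep]

theorem eq_of_lineOf_eq {N : ℕ} {b : Bool} {u v : Torus N} (h1 : lineOf b u = lineOf b v)
    (h2 : lineOf (!b) u = lineOf (!b) v) : u = v := by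
  cases b <;> simp_all [lineOf, Prod.ext_iff]

theorem exists_add_nsmul_eq {N : ℕ} [NeZero N] {b : Bool} {u v : Torus N}
    (h : lineOf b u = lineOf b v) : ∃ n < N, v = u + n • edgeStep N b := by
  refine ⟨(lineOf (!b) v - lineOf (!b) u).val, ZMod.val_lt _, eq_of_lineOf_eq (b := b) ?_ ?_⟩
  · rw [lineOf_add_nsmul, h]
  · rw [lineOf_not_add_nsmul]; simp

theorem lineOf_mem_hits {N : ℕ} [NeZero N] {D : Finset (Torus N)} {b : Bool} {v : Torus N}
    (h : (v, b) ∈ bd D) : lineOf b v ∈ hits D b :=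
  Finset.mem_image.2 ⟨(v, b), Finset.mem_filter.2 ⟨h, rfl⟩, rfl⟩

theorem ind_eq_of_notMem_hits {N : ℕ} [NeZero N] {D : Finset (Torus N)} {b : Bool} {u v : Torus N}
    (hl : lineOf b u ∉ hits D b) (h : lineOf b u = lineOf b v) : ind D u = ind D v := by
  obtain ⟨n, -, rfl⟩ := exists_add_nsmul_eq h
  refine (eq_add_nsmul_of_grad_eq_zero fun k _ => ?_).symm
  by_contra h0
  exact hl (lineOf_add_nsmul b u k ▸ lineOf_mem_hits (mem_bd.2 h0))

/-- Every line crossed by the boundary is crossed at least twice. -/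
theorem two_mul_card_hits_le {N : ℕ} [NeZero N] (D : Finset (Torus N)) (b : Bool) :
    2 * (hits D b).card ≤ ((bd D).filter fun e => e.2 = b).card := by
  refine Finset.mul_card_image_le_card_of_maps_to (f := fun e : TorusEdge N => lineOf b e.1)
    (fun e he => Finset.mem_image.2 ⟨e, he, rfl⟩) 2 ?_
  intro l hl
  obtain ⟨⟨v, b'⟩, he, rfl⟩ := Finset.mem_image.1 hl
  obtain ⟨hev, rfl⟩ := Finset.mem_filter.1 he
  simp only at hev he ⊢
  by_cases hk : ∃ k < N - 1, (v + (k + 1) • edgeStep N b', b') ∈ bd D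
  · obtain ⟨k, hk, hkb⟩ := hk
    have hne : v + (k + 1) • edgeStep N b' ≠ v := by
      intro h
      have := lineOf_not_add_nsmul b' v (k + 1)
      rw [h] at this
      have h0 : ((k + 1 : ℕ) : ZMod N) = 0 := by simpa using this
      rw [ZMod.natCast_eq_zero_iff] at h0
      have := Nat.le_of_dvd (by omega) h0
      omega
    refine le_trans (le_of_eq ?_) (Finset.card_le_card
      (s := {(v, b'), (v + (k + 1) • edgeStep N b', b')}) ?_)
    · rw [Finset.card_pair]
      intro h
      exact hne (Prod.ext_iff.1 h).1.symm
    · intro e he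
      rw [Finset.mem_insert, Finset.mem_singleton] at he
      rcases he with rfl | rfl
      · simp [hev]
      · simp only [Finset.mem_filter]
        exact ⟨⟨hkb, trivial⟩, lineOf_add_nsmul _ _ _⟩
  · push Not at hk
    exfalso
    have := eq_add_nsmul_of_grad_eq_zero (f := ind D) (b := b') (v := v + edgeStep N b')
      (n := N - 1) (fun k hk' => by
        by_contra h0
        refine hk k hk' (mem_bd.2 ?_)
        rwa [succ_nsmul', ← add_assoc])
    rw [add_assoc, ← succ_nsmul', Nat.sub_add_cancel (NeZero.one_le)] at this
    have h0 : N • edgeStep N b' = 0 := by cases b' <;> simp [edgeStep]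
    rw [h0, add_zero] at this
    refine mem_bd.1 hev ?_
    simp [grad, this]

theorem two_mul_hits_add_le {N : ℕ} [NeZero N] (D : Finset (Torus N)) (b : Bool) :
    2 * (hits D b).card + 2 * (hits D (!b)).card ≤ (bd D).card := by
  have h1 := two_mul_card_hits_le D b
  have h2 := two_mul_card_hits_le D (!b)
  have h3 := Finset.card_filter_add_card_filter_not (s := bd D) (fun e => e.2 = b)
  have h4 : ((bd D).filter fun e => ¬ e.2 = b) = (bd D).filter fun e => e.2 = !b := by
    refine Finset.filter_congr fun e _ => ?_
    cases e.2 <;> cases b <;> simp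
  rw [h4] at h3
  omega

theorem four_le_card_bd {N : ℕ} [NeZero N] (hN : 2 ≤ N) {D : Finset (Torus N)} {i j : Torus N}
    (hi : i ∈ D) (hj : j ∉ D) : 4 ≤ (bd D).card := by
  have key : ∀ b, (hits D b).card = 0 → N ≤ (hits D (!b)).card := by
    intro b hb
    rw [Finset.card_eq_zero] at hb
    suffices h : hits D (!b) = Finset.univ by rw [h, Finset.card_univ, ZMod.card]
    refine Finset.eq_univ_of_forall fun l => ?_
    by_contra hl
    obtain ⟨u, hu1, hu2⟩ : ∃ u : Torus N, lineOf b u = lineOf b i ∧ lineOf (!b) u = l := by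
      cases b
      · exact ⟨(l, i.2), by simp [lineOf]⟩
      · exact ⟨(i.1, l), by simp [lineOf]⟩
    obtain ⟨w, hw1, hw2⟩ : ∃ u : Torus N, lineOf b u = lineOf b j ∧ lineOf (!b) u = l := by
      cases b
      · exact ⟨(l, j.2), by simp [lineOf]⟩
      · exact ⟨(j.1, l), by simp [lineOf]⟩
    have e1 := ind_eq_of_notMem_hits (D := D) (by rw [hb]; simp) hu1
    have e2 := ind_eq_of_notMem_hits (D := D) (by rw [hb]; simp) hw1
    have e3 := ind_eq_of_notMem_hits (D := D) (u := u) (v := w) (by rwa [hu2]) (by rw [hu2, hw2])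
    have : ind D i = ind D j := by rw [← e1, ← e2, e3]
    simp [ind, hi, hj] at this
  have h1 := two_mul_hits_add_le D false
  have h2 := key false
  have h3 := key true
  simp only [Bool.not_false, Bool.not_true] at *
  omega

/-- Moving along a line, one soon meets a transversal line which is not crossed. -/
theorem exists_lineOf_notMem_hits {N : ℕ} [NeZero N] {D : Finset (Torus N)} {b : Bool}
    (hc : (hits D (!b)).card < N) (u : Torus N) :
    ∃ t ≤ (hits D (!b)).card, lineOf (!b) (u + t • edgeStep N b) ∉ hits D (!b) := by
  by_contra! h
  have := Finset.card_le_card_of_injOn (s := Finset.range ((hits D (!b)).card + 1))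
    (t := hits D (!b)) (fun t => lineOf (!b) (u + t • edgeStep N b))
    (fun t ht => h t (Nat.lt_succ_iff.1 (Finset.mem_range.1 ht))) (by
      intro s hs t ht hst
      simp only [lineOf_not_add_nsmul, add_right_inj] at hst
      rw [ZMod.natCast_eq_natCast_iff'] at hst
      simp only [Finset.coe_range, Set.mem_Iio] at hs ht
      rwa [Nat.mod_eq_of_lt (by omega), Nat.mod_eq_of_lt (by omega)] at hst)
  simp at this

/-- A short cut separating `i` from `j` crosses the row of `i` or the column of `j` nearby. -/
theorem exists_near_mem_bd {N : ℕ} [NeZero N] {D : Finset (Torus N)} {i j : Torus N}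
    (hi : i ∈ D) (hj : j ∉ D) (hL : (bd D).card < 2 * N) :
    ∃ t < (bd D).card, (i + t • edgeStep N false, false) ∈ bd D ∨
      (j + t • edgeStep N true, true) ∈ bd D := by
  by_contra! h
  have h1 := two_mul_hits_add_le D false
  simp only [Bool.not_false] at h1
  obtain ⟨t, ht, htl⟩ := exists_lineOf_notMem_hits (D := D) (b := false) (by simp; omega) i
  obtain ⟨s, hs, hsl⟩ := exists_lineOf_notMem_hits (D := D) (b := true) (by simp; omega) j
  simp only [Bool.not_false, Bool.not_true] at ht htl hs hsl
  have e1 := eq_add_nsmul_of_grad_eq_zero (f := ind D) (b := false) (v := i) (n := t)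
    (fun k hk => by
      by_contra h0
      exact (h k (by omega)).1 (mem_bd.2 h0))
  have e2 := eq_add_nsmul_of_grad_eq_zero (f := ind D) (b := true) (v := j) (n := s)
    (fun k hk => by
      by_contra h0
      exact (h k (by omega)).2 (mem_bd.2 h0))
  have e3 := ind_eq_of_notMem_hits (v := ((i + t • edgeStep N false).1, (j + s • edgeStep N true).2))
    htl (by simp [lineOf])
  have e4 := ind_eq_of_notMem_hits (v := ((i + t • edgeStep N false).1, (j + s • edgeStep N true).2))
    hsl (by simp [lineOf])
  have : ind D i = ind D j := by rw [← e1, ← e2, e3, e4]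
  simp [ind, hi, hj] at this

theorem bd_injOn {N : ℕ} [NeZero N] {D D' : Finset (Torus N)} {i : Torus N} (hi : i ∈ D)
    (hi' : i ∈ D') (h : bd D = bd D') : D = D' := by
  have hg : ∀ e, grad (fun v => (ind D v - ind D' v) ^ 2) e = 0 := by
    intro e
    have he : grad (ind D) e ≠ 0 ↔ grad (ind D') e ≠ 0 := by rw [← mem_bd, ← mem_bd, h]
    unfold grad ind at *
    split_ifs at * <;> simp_all
  ext v
  have := eq_of_grad_eq_zero hg v i
  simp only [ind, hi, hi', if_true, sub_self] at this
  by_cases h1 : v ∈ D <;> by_cases h2 : v ∈ D' <;> simp_all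

open Classical in
/-- The irreducible cuts separating `i` from `j`, containing `i`. -/
noncomputable def cuts {N : ℕ} [NeZero N] (i j : Torus N) : Finset (Finset (Torus N)) :=
  Finset.univ.filter fun D => i ∈ D ∧ j ∉ D ∧ IsIrredCut D

theorem mem_cuts {N : ℕ} [NeZero N] {i j : Torus N} {D : Finset (Torus N)} :
    D ∈ cuts i j ↔ i ∈ D ∧ j ∉ D ∧ IsIrredCut D := by
  simp [cuts]

/-- Boundaries of length `L` containing a fixed seed `K` that meets all their
plaquette-components number at most `4 ^ L`. -/
theorem card_seeded_le {N : ℕ} [NeZero N] (hN : 2 ≤ N) {L : ℕ} (K : Finset (TorusEdge N))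
    (F : Finset (Finset (TorusEdge N))) (hF : ∀ Γ ∈ F, ∃ D, Γ = bd D) (hL : ∀ Γ ∈ F, Γ.card = L)
    (hK : ∀ Γ ∈ F, K ⊆ Γ)
    (hconn : ∀ Γ ∈ F, ∀ γ ⊆ Γ, (∀ v, Disjoint γ (plaq v) ∨ Γ ∩ plaq v ⊆ γ) → Disjoint γ K →
      γ = ∅) : F.card ≤ 4 ^ L := by
  have hev : ∀ Γ ∈ F, ∀ v, Even (Γ ∩ plaq v).card := by
    intro Γ hΓ v
    obtain ⟨D, rfl⟩ := hF Γ hΓ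
    exact even_card_bd_inter_plaq hN D v
  refine card_le_four_pow_of_explored plaq (card_plaq hN) L K ∅ F hK (by simp) hev hconn ?_
  intro Γ hΓ
  simpa [hL Γ hΓ] using card_touched_le plaq card_plaq_containing_le Γ (hev Γ hΓ)

theorem card_short_boundaries_le {N : ℕ} [NeZero N] (hN : 2 ≤ N) (i j : Torus N) {L : ℕ}
    (hL : L < 2 * N) (F : Finset (Finset (TorusEdge N))) (hF : ∀ Γ ∈ F, ∃ D ∈ cuts i j, Γ = bd D)
    (hFL : ∀ Γ ∈ F, Γ.card = L) : F.card ≤ 2 * L * 4 ^ L := by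
  have seed : ∀ e, (F.filter fun Γ => e ∈ Γ).card ≤ 4 ^ L := by
    intro e
    refine card_seeded_le hN {e} _ (fun Γ hΓ => ?_) (fun Γ hΓ => hFL Γ (Finset.mem_filter.1 hΓ).1)
      (fun Γ hΓ => by simpa using (Finset.mem_filter.1 hΓ).2) ?_
    · obtain ⟨D, -, h⟩ := hF Γ (Finset.mem_filter.1 hΓ).1
      exact ⟨D, h⟩
    · intro Γ hΓ γ hγ hs hd
      obtain ⟨hΓF, heΓ⟩ := Finset.mem_filter.1 hΓ
      obtain ⟨D, hD, rfl⟩ := hF Γ hΓF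
      have hcard := hFL _ hΓF
      have h1 := two_mul_hits_add_le D false
      simp only [Bool.not_false] at h1
      obtain ⟨s, -, hsl⟩ := exists_lineOf_notMem_hits (D := D) (b := true) (by simp; omega) i
      obtain ⟨t, -, htl⟩ := exists_lineOf_notMem_hits (D := D) (b := false) (by simp; omega) i
      rcases (mem_cuts.1 hD).2.2.eq_empty_or_eq_bd hγ hs
        (a₀ := lineOf true (i + t • edgeStep N false))
        (b₀ := lineOf false (i + s • edgeStep N true))
        (fun a ha => hsl (by
          have := lineOf_mem_hits (hγ ha)
          simpa [lineOf] using this))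
        (fun b hb => htl (by
          have := lineOf_mem_hits (hγ hb)
          simpa [lineOf] using this)) with h | h
      · exact h
      · exact absurd (h ▸ heΓ) (Finset.disjoint_singleton_right.1 hd)
  have hsub : F ⊆ (Finset.range L).biUnion fun t =>
      (F.filter fun Γ => (i + t • edgeStep N false, false) ∈ Γ) ∪
        F.filter fun Γ => (j + t • edgeStep N true, true) ∈ Γ := by
    intro Γ hΓ
    obtain ⟨D, hD, rfl⟩ := hF Γ hΓ
    have hcard := hFL _ hΓ
    obtain ⟨t, ht, h⟩ := exists_near_mem_bd (mem_cuts.1 hD).1 (mem_cuts.1 hD).2.1 (hcard ▸ hL)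
    simp only [Finset.mem_biUnion, Finset.mem_range, Finset.mem_union, Finset.mem_filter]
    exact ⟨t, hcard ▸ ht, h.imp (fun h => ⟨hΓ, h⟩) fun h => ⟨hΓ, h⟩⟩
  calc F.card ≤ _ := Finset.card_le_card hsub
    _ ≤ (Finset.range L).card * (4 ^ L + 4 ^ L) :=
        Finset.card_biUnion_le_card_mul _ _ _ fun t _ =>
          (Finset.card_union_le _ _).trans (add_le_add (seed _) (seed _))
    _ = 2 * L * 4 ^ L := by rw [Finset.card_range]; ring

theorem card_long_boundaries_le {N : ℕ} [NeZero N] (hN : 2 ≤ N) (i j : Torus N) {L : ℕ}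
    (hL : 2 * N ≤ L) (F : Finset (Finset (TorusEdge N))) (hF : ∀ Γ ∈ F, ∃ D ∈ cuts i j, Γ = bd D)
    (hFL : ∀ Γ ∈ F, Γ.card = L) : F.card ≤ 8 ^ L := by
  let R : Finset (TorusEdge N) := (Finset.univ : Finset (ZMod N × Bool)).image fun p =>
    if p.2 then ((j.1, p.1), true) else ((p.1, i.2), false)
  have hRrow : ∀ a, ((a, i.2), false) ∈ R := fun a =>
    Finset.mem_image.2 ⟨(a, false), Finset.mem_univ _, by simp⟩
  have hRcol : ∀ b, ((j.1, b), true) ∈ R := fun b =>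
    Finset.mem_image.2 ⟨(b, true), Finset.mem_univ _, by simp⟩
  have hR : R.card ≤ L := by
    refine Finset.card_image_le.trans ?_
    simp [ZMod.card]; omega
  have := Finset.card_le_mul_card_image_of_maps_to (s := F) (t := R.powerset)
    (f := fun Γ => Γ ∩ R) (fun Γ _ => Finset.mem_powerset.2 Finset.inter_subset_right) (4 ^ L) (by
      intro K _
      refine card_seeded_le hN K _ (fun Γ hΓ => ?_)
        (fun Γ hΓ => hFL Γ (Finset.mem_filter.1 hΓ).1)
        (fun Γ hΓ => (Finset.mem_filter.1 hΓ).2 ▸ Finset.inter_subset_left) ?_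
      · obtain ⟨D, -, h⟩ := hF Γ (Finset.mem_filter.1 hΓ).1
        exact ⟨D, h⟩
      · intro Γ hΓ γ hγ hs hd
        obtain ⟨hΓF, rfl⟩ := Finset.mem_filter.1 hΓ
        obtain ⟨D, hD, rfl⟩ := hF Γ hΓF
        have hdR : ∀ e ∈ γ, e ∉ R := fun e he heR =>
          Finset.disjoint_left.1 hd he (Finset.mem_inter.2 ⟨hγ he, heR⟩)
        obtain ⟨hi, hj, hirr⟩ := mem_cuts.1 hD
        rcases hirr.eq_empty_or_eq_bd hγ hs (a₀ := j.1) (b₀ := i.2)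
          (fun a ha => hdR _ ha (hRrow a)) (fun b hb => hdR _ hb (hRcol b)) with h | h
        · exact h
        · subst h
          exfalso
          have e1 := ind_eq_of_notMem_hits (D := D) (b := false) (u := i) (v := (j.1, i.2)) (by
            intro hm
            obtain ⟨⟨v, b⟩, he, hl⟩ := Finset.mem_image.1 hm
            obtain ⟨heb, rfl⟩ := Finset.mem_filter.1 he
            refine hdR _ heb ?_
            have : v = (v.1, i.2) := Prod.ext rfl (by simpa [lineOf] using hl)
            rw [this]
            exact hRrow _) (by simp [lineOf])
          have e2 := ind_eq_of_notMem_hits (D := D) (b := true) (u := j) (v := (j.1, i.2)) (by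
            intro hm
            obtain ⟨⟨v, b⟩, he, hl⟩ := Finset.mem_image.1 hm
            obtain ⟨heb, rfl⟩ := Finset.mem_filter.1 he
            refine hdR _ heb ?_
            have : v = (j.1, v.2) := Prod.ext (by simpa [lineOf] using hl) rfl
            rw [this]
            exact hRcol _) (by simp [lineOf])
          have : ind D i = ind D j := by rw [e1, e2]
          simp [ind, hi, hj] at this)
  calc F.card ≤ 4 ^ L * R.powerset.card := this
    _ ≤ 4 ^ L * 2 ^ L := by
        rw [Finset.card_powerset]
        exact Nat.mul_le_mul_left _ (Nat.pow_le_pow_right (by norm_num) hR)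
    _ = 8 ^ L := by rw [← mul_pow]; norm_num

theorem card_cuts_le {N : ℕ} [NeZero N] (hN : 2 ≤ N) (i j : Torus N) {L : ℕ} (hL : 4 ≤ L) :
    ((cuts i j).filter fun D => (bd D).card = L).card ≤ 8 ^ L := by
  have himg : (((cuts i j).filter fun D => (bd D).card = L).image bd).card =
      ((cuts i j).filter fun D => (bd D).card = L).card := by
    refine Finset.card_image_of_injOn fun D hD D' hD' h => ?_
    simp only [Finset.coe_filter, Set.mem_ofPred_eq, mem_cuts] at hD hD'
    exact bd_injOn hD.1.1 hD'.1.1 h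
  rw [← himg]
  have hF : ∀ Γ ∈ ((cuts i j).filter fun D => (bd D).card = L).image bd,
      ∃ D ∈ cuts i j, Γ = bd D := by
    intro Γ hΓ
    obtain ⟨D, hD, rfl⟩ := Finset.mem_image.1 hΓ
    exact ⟨D, (Finset.mem_filter.1 hD).1, rfl⟩
  have hFL : ∀ Γ ∈ ((cuts i j).filter fun D => (bd D).card = L).image bd, Γ.card = L := by
    intro Γ hΓ
    obtain ⟨D, hD, rfl⟩ := Finset.mem_image.1 hΓ
    exact (Finset.mem_filter.1 hD).2
  rcases lt_or_ge L (2 * N) with h | h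
  · refine (card_short_boundaries_le hN i j h _ hF hFL).trans ?_
    have h2 : 2 * L ≤ 2 ^ L := by
      clear h hF hFL himg
      induction L, hL using Nat.le_induction with
      | base => norm_num
      | succ n hn ih => rw [pow_succ]; omega
    calc 2 * L * 4 ^ L ≤ 2 ^ L * 4 ^ L := Nat.mul_le_mul_right _ h2
      _ = 8 ^ L := by rw [← mul_pow]; norm_num
  · exact card_long_boundaries_le hN i j h _ hF hFL

/-- The Peierls sum over irreducible cuts. -/
theorem sum_cuts_le {N : ℕ} [NeZero N] (hN : 2 ≤ N) (i j : Torus N) {z : ℝ} (hz0 : 0 ≤ z)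
    (hz : z ≤ 1 / 20) : ∑ D ∈ cuts i j, z ^ (bd D).card ≤ 38880 * z ^ 4 := by
  let M := (cuts i j).sup (fun D => (bd D).card) + 1
  have hmaps : ∀ D ∈ cuts i j, (bd D).card - 4 ∈ Finset.range M := by
    intro D hD
    rw [Finset.mem_range]
    have := Finset.le_sup (f := fun D : Finset (Torus N) => (bd D).card) hD
    simp only [M]
    omega
  rw [← Finset.sum_fiberwise_of_maps_to hmaps]
  have h1 : ∀ k ∈ Finset.range M,
      ∑ D ∈ (cuts i j).filter (fun D => (bd D).card - 4 = k), z ^ (bd D).card ≤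
        (8 * z) ^ 4 * (8 * z) ^ k := by
    intro k _
    have hfil : (cuts i j).filter (fun D => (bd D).card - 4 = k) =
        (cuts i j).filter fun D => (bd D).card = 4 + k := by
      refine Finset.filter_congr fun D hD => ?_
      have := four_le_card_bd hN (mem_cuts.1 hD).1 (mem_cuts.1 hD).2.1
      omega
    rw [hfil, Finset.sum_congr rfl (g := fun _ => z ^ (4 + k)) (fun D hD => by
      rw [(Finset.mem_filter.1 hD).2]), Finset.sum_const, nsmul_eq_mul, ← pow_add, mul_pow]
    refine mul_le_mul_of_nonneg_right ?_ (by positivity)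
    exact_mod_cast card_cuts_le hN i j (by omega)
  refine (Finset.sum_le_sum h1).trans ?_
  rw [← Finset.mul_sum]
  have hsum : ∑ k ∈ Finset.range M, (8 * z) ^ k ≤ (1 - 8 * z)⁻¹ := by
    rw [← tsum_geometric_of_lt_one (by positivity) (by linarith)]
    exact (summable_geometric_of_lt_one (by positivity) (by linarith)).sum_le_tsum _
      fun k _ => by positivity
  have h2 : (1 - 8 * z)⁻¹ ≤ 2 := by
    rw [inv_le_comm₀ (by linarith) (by norm_num)]
    linarith
  calc (8 * z) ^ 4 * ∑ k ∈ Finset.range M, (8 * z) ^ k ≤ (8 * z) ^ 4 * 2 := by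
        gcongr; exact hsum.trans h2
    _ ≤ 38880 * z ^ 4 := by
        have : 0 ≤ z ^ 4 := by positivity
        nlinarith

/-- Extension by `0` at the root of a function on the non-root vertices. -/
def pin {N : ℕ} {R : Type*} [Zero R] (x : {v : Torus N // v ≠ 0} → R) (v : Torus N) : R :=
  if h : v = 0 then 0 else x ⟨v, h⟩

/-- The weight of a pinned integer height function in the discrete Gaussian model. -/
noncomputable def gaussWeight {N : ℕ} [NeZero N] (β : ℝ) (x : {v : Torus N // v ≠ 0} → ℤ) : ℝ :=
  Real.exp (-β * energy (pin x))

/-- The height difference between two vertices. -/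
def heightDiff {N : ℕ} (i j : Torus N) (x : {v : Torus N // v ≠ 0} → ℤ) : ℤ := pin x i - pin x j

theorem pin_neg {N : ℕ} (x : {v : Torus N // v ≠ 0} → ℤ) (v : Torus N) :
    pin (-x) v = -pin x v := by
  unfold pin; split_ifs <;> simp

theorem energy_neg {N : ℕ} [NeZero N] (x : Torus N → ℤ) : energy (fun v => -x v) = energy x := by
  refine Finset.sum_congr rfl fun e _ => ?_
  unfold grad; ring

theorem gaussWeight_neg {N : ℕ} [NeZero N] (β : ℝ) (x : {v : Torus N // v ≠ 0} → ℤ) :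
    gaussWeight β (-x) = gaussWeight β x := by
  unfold gaussWeight
  rw [show pin (-x) = fun v => -pin x v from funext (pin_neg x), energy_neg]

theorem heightDiff_neg {N : ℕ} (i j : Torus N) (x : {v : Torus N // v ≠ 0} → ℤ) :
    heightDiff i j (-x) = -heightDiff i j x := by
  unfold heightDiff; rw [pin_neg, pin_neg]; ring

theorem HasSum.comp_neg {G : Type*} [AddGroup G] {f : G → ℝ} {s : ℝ} (h : HasSum f s) :
    HasSum (fun x => f (-x)) s :=
  (Equiv.neg G).hasSum_iff.2 h

theorem HasSum.comp_sub_right {G : Type*} [AddGroup G] {f : G → ℝ} {s : ℝ} (h : HasSum f s)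
    (g : G) : HasSum (fun x => f (x - g)) s :=
  (Equiv.subRight g).hasSum_iff.2 h

/-- The indicator of a set of vertices, normalized to vanish at the root. -/
def pinnedInd {N : ℕ} (D : Finset (Torus N)) (s : {v : Torus N // v ≠ 0}) : ℤ :=
  ind D s - ind D 0

theorem pin_sub_pinnedInd {N : ℕ} (x : {v : Torus N // v ≠ 0} → ℤ) (D : Finset (Torus N))
    (v : Torus N) : pin (x - pinnedInd D) v = pin x v - ind D v + ind D 0 := by
  unfold pin pinnedInd
  split_ifs with h
  · subst h; ring
  · simp; ring

theorem energy_pin_sub_pinnedInd {N : ℕ} [NeZero N] (x : {v : Torus N // v ≠ 0} → ℤ)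
    (D : Finset (Torus N)) :
    energy (pin (x - pinnedInd D)) = energy (fun v => pin x v - ind D v) := by
  refine Finset.sum_congr rfl fun e _ => ?_
  unfold grad; simp only [pin_sub_pinnedInd]; ring

/-- Peierls comparison: lowering the heights inside a cut trades a descent by one for a
geometric factor. -/
theorem tsum_descend_le {N : ℕ} [NeZero N] {β : ℝ} (hβ : 0 ≤ β) (i j : Torus N) {h : ℤ → ℝ}
    (hh : ∀ n, 1 ≤ n → 0 ≤ h n)
    (hg : Summable fun x : {v : Torus N // v ≠ 0} → ℤ =>
      if 0 ≤ heightDiff i j x then h (heightDiff i j x + 1) * gaussWeight β x else 0) :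
    ∑' x : {v : Torus N // v ≠ 0} → ℤ,
        (if 1 ≤ heightDiff i j x then h (heightDiff i j x) * gaussWeight β x else 0) ≤
      (∑ D ∈ cuts i j, Real.exp (-β) ^ (bd D).card) *
        ∑' x : {v : Torus N // v ≠ 0} → ℤ,
          if 0 ≤ heightDiff i j x then h (heightDiff i j x + 1) * gaussWeight β x else 0 := by
  set g : ({v : Torus N // v ≠ 0} → ℤ) → ℝ := fun x =>
      if 0 ≤ heightDiff i j x then h (heightDiff i j x + 1) * gaussWeight β x else 0 with hgdef
  have hg0 : ∀ x, 0 ≤ g x := by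
    intro x
    simp only [hgdef]
    split_ifs with h0
    · exact mul_nonneg (hh _ (by omega)) (Real.exp_pos _).le
    · exact le_rfl
  have hshift : ∀ D : Finset (Torus N), Summable fun x => g (x - pinnedInd D) := fun D =>
    (hg.hasSum.comp_sub_right (pinnedInd D)).summable
  have hsum : Summable fun x => ∑ D ∈ cuts i j, Real.exp (-β) ^ (bd D).card *
      g (x - pinnedInd D) := summable_sum fun D _ => (hshift D).mul_left _
  have hpt : ∀ x, (if 1 ≤ heightDiff i j x then h (heightDiff i j x) * gaussWeight β x else 0) ≤
      ∑ D ∈ cuts i j, Real.exp (-β) ^ (bd D).card * g (x - pinnedInd D) := by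
    intro x
    have hnn : ∀ D ∈ cuts i j, 0 ≤ Real.exp (-β) ^ (bd D).card * g (x - pinnedInd D) :=
      fun D _ => mul_nonneg (by positivity) (hg0 _)
    split_ifs with h1
    swap
    · exact Finset.sum_nonneg hnn
    obtain ⟨D, hi, hj, hirr, hD⟩ := exists_isIrredCut (x := pin x) (i := i) (j := j)
      (by unfold heightDiff at h1; omega)
    refine le_trans ?_ (Finset.single_le_sum hnn (mem_cuts.2 ⟨hi, hj, hirr⟩))
    have hd : heightDiff i j (x - pinnedInd D) = heightDiff i j x - 1 := by
      unfold heightDiff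
      rw [pin_sub_pinnedInd, pin_sub_pinnedInd]
      simp [ind, hi, hj]; ring
    simp only [hgdef]
    rw [hd, if_pos (by omega), sub_add_cancel, mul_left_comm]
    refine mul_le_mul_of_nonneg_left ?_ (hh _ h1)
    unfold gaussWeight
    rw [energy_pin_sub_pinnedInd, ← Real.exp_nat_mul, ← Real.exp_add, Real.exp_le_exp]
    have he : ((energy (fun v => pin x v - ind D v) + (bd D).card : ℤ) : ℝ) ≤ energy (pin x) :=
      Int.cast_le.2 (energy_sub_ind_le hD)
    push_cast at he
    nlinarith
  have hf0 : ∀ x, 0 ≤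
      (if 1 ≤ heightDiff i j x then h (heightDiff i j x) * gaussWeight β x else 0) := by
    intro x
    split_ifs with h0
    · exact mul_nonneg (hh _ h0) (Real.exp_pos _).le
    · exact le_rfl
  refine ((Summable.of_nonneg_of_le hf0 hpt hsum).tsum_le_tsum hpt hsum).trans ?_
  rw [Summable.tsum_finsetSum fun D _ => (hshift D).mul_left _, Finset.sum_mul]
  refine Finset.sum_le_sum fun D _ => ?_
  rw [tsum_mul_left, (hg.hasSum.comp_sub_right (pinnedInd D)).tsum_eq]

/-- The second moment of a height difference in the discrete Gaussian model at low temperature. -/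
theorem tsum_heightDiff_sq_le {N : ℕ} [NeZero N] (hN : 2 ≤ N) {β : ℝ} (hβ : 3 ≤ β) (i j : Torus N)
    (hs0 : Summable fun x : {v : Torus N // v ≠ 0} → ℤ => gaussWeight β x)
    (hs2 : Summable fun x : {v : Torus N // v ≠ 0} → ℤ =>
      (heightDiff i j x : ℝ) ^ 2 * gaussWeight β x) {φ : ℝ}
    (hφ : φ = 480 * (3 * Real.exp (-β)) ^ 4) :
    ∑' x : {v : Torus N // v ≠ 0} → ℤ, (heightDiff i j x : ℝ) ^ 2 * gaussWeight β x ≤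
      2 * φ * (1 + φ) / (1 - φ) ^ 3 * ∑' x : {v : Torus N // v ≠ 0} → ℤ, gaussWeight β x := by
  have hz : Real.exp (-β) ≤ 1 / 20 := by
    have h1 : Real.exp (-β) ≤ Real.exp (-3) := Real.exp_le_exp.2 (by linarith)
    have h2 : Real.exp (-3) ≤ 1 / 20 := by
      rw [Real.exp_neg, inv_le_comm₀ (Real.exp_pos _) (by norm_num)]
      have h3 : Real.exp 3 = Real.exp 1 ^ 3 := by rw [← Real.exp_nat_mul]; norm_num
      have h4 := Real.exp_one_gt_d9
      rw [h3]
      calc ((1 / 20 : ℝ))⁻¹ ≤ (2.7182818283 : ℝ) ^ 3 := by norm_num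
        _ ≤ _ := by gcongr
    exact h1.trans h2
  have hφ0 : 0 ≤ φ := by rw [hφ]; positivity
  have hφ1 : φ < 1 := by
    have : Real.exp (-β) ^ 4 ≤ (1 / 20) ^ 4 := by gcongr
    rw [hφ, mul_pow]
    nlinarith
  have hp : ∑ D ∈ cuts i j, Real.exp (-β) ^ (bd D).card ≤ φ := by
    refine (sum_cuts_le hN i j (Real.exp_pos _).le hz).trans (le_of_eq ?_)
    rw [hφ]; ring
  have hW0 : ∀ x : {v : Torus N // v ≠ 0} → ℤ, 0 ≤ gaussWeight β x := fun x => (Real.exp_pos _).le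
  let T : ({v : Torus N // v ≠ 0} → ℤ) → ℝ := fun x => (heightDiff i j x : ℝ)
  let a : ({v : Torus N // v ≠ 0} → ℤ) → ℝ := fun x =>
    if heightDiff i j x = 0 then gaussWeight β x else 0
  let A : ℕ → ({v : Torus N // v ≠ 0} → ℤ) → ℝ := fun k x =>
    if 1 ≤ heightDiff i j x then (heightDiff i j x : ℝ) ^ k * gaussWeight β x else 0
  have ha0 : ∀ x, 0 ≤ a x := fun x => by
    simp only [a]; split_ifs; exacts [hW0 x, le_rfl]
  have hale : ∀ x, a x ≤ gaussWeight β x := fun x => by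
    simp only [a]; split_ifs; exacts [le_rfl, hW0 x]
  have ha : Summable a := Summable.of_nonneg_of_le ha0 hale hs0
  have hA0 : ∀ k x, 0 ≤ A k x := by
    intro k x
    simp only [A]
    split_ifs with h
    · have : (1 : ℝ) ≤ heightDiff i j x := by exact_mod_cast h
      exact mul_nonneg (pow_nonneg (by linarith) _) (hW0 x)
    · exact le_rfl
  have hA : ∀ k ≤ 2, Summable (A k) := by
    intro k hk
    refine Summable.of_nonneg_of_le (hA0 k) (fun x => ?_) hs2
    simp only [A]
    split_ifs with h
    · have : (1 : ℝ) ≤ heightDiff i j x := by exact_mod_cast h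
      exact mul_le_mul_of_nonneg_right (pow_le_pow_right₀ this hk) (hW0 x)
    · exact mul_nonneg (sq_nonneg _) (hW0 x)
  have split : ∀ (h : ℤ → ℝ) (x : {v : Torus N // v ≠ 0} → ℤ),
      (if 0 ≤ heightDiff i j x then h (heightDiff i j x + 1) * gaussWeight β x else 0) =
        h 1 * a x +
          if 1 ≤ heightDiff i j x then h (heightDiff i j x + 1) * gaussWeight β x else 0 := by
    intro h x
    simp only [a]
    rcases lt_trichotomy (heightDiff i j x) 0 with h0 | h0 | h0
    · rw [if_neg (by omega), if_neg (by omega), if_neg (by omega)]; ring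
    · rw [if_pos (by omega), if_pos h0, if_neg (by omega), h0]; simp
    · rw [if_pos (by omega), if_neg (by omega), if_pos (by omega)]; ring
  set sa := ∑' x, a x
  set s0 := ∑' x, A 0 x
  set s1 := ∑' x, A 1 x
  set s2 := ∑' x, A 2 x
  have n0 : 0 ≤ s0 := tsum_nonneg (hA0 0)
  have n1 : 0 ≤ s1 := tsum_nonneg (hA0 1)
  have n2 : 0 ≤ s2 := tsum_nonneg (hA0 2)
  have na : 0 ≤ sa := tsum_nonneg ha0
  have S0 := (hA 0 (by norm_num)).hasSum
  have S1 := (hA 1 (by norm_num)).hasSum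
  have S2 := (hA 2 le_rfl).hasSum
  have hβ0 : 0 ≤ β := by linarith
  have b0 : s0 ≤ φ * (sa + s0) := by
    have hs : HasSum (fun x => if 0 ≤ heightDiff i j x then (1 : ℝ) * gaussWeight β x else 0)
        (sa + s0) := by
      refine (ha.hasSum.add S0).congr_fun ?_
      intro x
      rw [split (fun _ => 1) x]
      simp [A]
    have := tsum_descend_le hβ0 i j (h := fun _ => 1) (fun _ _ => zero_le_one) hs.summable
    rw [hs.tsum_eq] at this
    refine le_trans (le_of_eq ?_) (this.trans (mul_le_mul_of_nonneg_right hp (by positivity)))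
    exact tsum_congr fun x => by simp [A]
  have b1 : s1 ≤ φ * (sa + (s1 + s0)) := by
    have hs : HasSum (fun x => if 0 ≤ heightDiff i j x then
        ((heightDiff i j x + 1 : ℤ) : ℝ) * gaussWeight β x else 0) (sa + (s1 + s0)) := by
      refine (ha.hasSum.add (S1.add S0)).congr_fun ?_
      intro x
      rw [split (fun n => (n : ℝ)) x]
      simp only [A]
      split_ifs <;> push_cast <;> ring
    have := tsum_descend_le hβ0 i j (h := fun n => (n : ℝ))
      (fun n hn => by exact_mod_cast (by omega : 0 ≤ n)) hs.summable
    rw [hs.tsum_eq] at this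
    refine le_trans (le_of_eq ?_) (this.trans (mul_le_mul_of_nonneg_right hp (by positivity)))
    exact tsum_congr fun x => by simp [A]
  have b2 : s2 ≤ φ * (sa + (s2 + 2 * s1 + s0)) := by
    have hs : HasSum (fun x => if 0 ≤ heightDiff i j x then
        ((heightDiff i j x + 1 : ℤ) : ℝ) ^ 2 * gaussWeight β x else 0)
        (sa + (s2 + 2 * s1 + s0)) := by
      refine (ha.hasSum.add ((S2.add (S1.mul_left 2)).add S0)).congr_fun ?_
      intro x
      rw [split (fun n => (n : ℝ) ^ 2) x]
      simp only [A]
      split_ifs <;> push_cast <;> ring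
    have := tsum_descend_le hβ0 i j (h := fun n => (n : ℝ) ^ 2) (fun n hn => sq_nonneg _)
      hs.summable
    rw [hs.tsum_eq] at this
    exact this.trans (mul_le_mul_of_nonneg_right hp (by positivity))
  have htot : ∑' x : {v : Torus N // v ≠ 0} → ℤ, (heightDiff i j x : ℝ) ^ 2 * gaussWeight β x =
      s2 + s2 := by
    have hneg : HasSum (fun x => A 2 (-x)) s2 := S2.comp_neg
    rw [← (S2.add hneg).tsum_eq]
    refine tsum_congr fun x => ?_
    simp only [A, heightDiff_neg, gaussWeight_neg]
    rcases lt_trichotomy (heightDiff i j x) 0 with h0 | h0 | h0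
    · rw [if_neg (by omega), if_pos (by omega)]; push_cast; ring
    · rw [if_neg (by omega), if_neg (by omega), h0]; simp
    · rw [if_pos (by omega), if_neg (by omega)]; ring
  have hsa : sa ≤ ∑' x : {v : Torus N // v ≠ 0} → ℤ, gaussWeight β x :=
    ha.tsum_le_tsum hale hs0
  have hq : 0 < 1 - φ := by linarith
  rw [htot]
  refine le_trans ?_ (mul_le_mul_of_nonneg_left hsa (by positivity))
  rw [div_mul_eq_mul_div, le_div_iff₀ (by positivity)]
  have c0 : (1 - φ) * s0 ≤ φ * sa := by linarith
  have c1 : (1 - φ) ^ 2 * s1 ≤ φ * sa := by nlinarith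
  have c2 : (1 - φ) * s2 ≤ φ * (2 * s1 + s0 + sa) := by linarith
  have c3 : (1 - φ) ^ 3 * s2 ≤ φ * (2 * ((1 - φ) ^ 2 * s1) + (1 - φ) * ((1 - φ) * s0)
      + (1 - φ) ^ 2 * sa) := by
    have := mul_le_mul_of_nonneg_left c2 (by positivity : 0 ≤ (1 - φ) ^ 2)
    linarith
  have c4 : φ * (2 * ((1 - φ) ^ 2 * s1) + (1 - φ) * ((1 - φ) * s0) + (1 - φ) ^ 2 * sa) ≤
      φ * (2 * (φ * sa) + (1 - φ) * (φ * sa) + (1 - φ) ^ 2 * sa) := by gcongr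
  linarith

theorem summable_prod_apply {ι α : Type*} [Fintype ι] {f : α → ℝ} (h0 : ∀ n, 0 ≤ f n)
    (hf : Summable f) : Summable fun x : ι → α => ∏ s, f (x s) := by
  classical
  refine summable_of_sum_le (c := ∏ _s : ι, ∑' n, f n)
    (fun x => Finset.prod_nonneg fun s _ => h0 _) fun u => ?_
  have hu : u ⊆ Fintype.piFinset fun s => u.image fun x => x s := fun x hx =>
    Fintype.mem_piFinset.2 fun s => Finset.mem_image_of_mem _ hx
  calc ∑ x ∈ u, ∏ s, f (x s) ≤ ∑ x ∈ Fintype.piFinset fun s => u.image fun x => x s, ∏ s, f (x s) :=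
        Finset.sum_le_sum_of_subset_of_nonneg hu fun x _ _ => Finset.prod_nonneg fun s _ => h0 _
    _ = ∏ s, ∑ n ∈ u.image fun x => x s, f n := (Finset.prod_univ_sum _ _).symm
    _ ≤ ∏ _s : ι, ∑' n, f n := Finset.prod_le_prod
        (fun s _ => Finset.sum_nonneg fun n _ => h0 n)
        fun s _ => hf.sum_le_tsum _ fun n _ => h0 n

theorem summable_exp_neg_abs_int : Summable fun n : ℤ => Real.exp (-|(n : ℝ)|) := by
  have h := Real.summable_exp_neg_nat
  refine Summable.of_nat_of_neg ?_ ?_ <;> simpa using h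

/-- Gaussian sums over a lattice converge, even with an exponential factor. -/
theorem summable_exp_neg_norm_sq_add {ι E : Type*} [Fintype ι] [NormedAddCommGroup E]
    [InnerProductSpace ℝ E] (T : (ι → ℝ) →ₗ[ℝ] E) (hT : Function.Injective T) (a : ℝ) :
    Summable fun x : ι → ℤ =>
      Real.exp (-‖T fun s => (x s : ℝ)‖ ^ 2 + a * ‖fun s => (x s : ℝ)‖) := by
  obtain ⟨K, hK, hanti⟩ := T.exists_antilipschitzWith (LinearMap.ker_eq_bot.2 hT)
  have hK' : (0 : ℝ) < K := hK
  have hle : ∀ y, ‖y‖ ≤ K * ‖T y‖ := fun y => by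
    simpa [dist_eq_norm] using hanti.le_mul_dist y 0
  set n : ℝ := (Fintype.card ι : ℝ)
  refine Summable.of_nonneg_of_le (fun x => (Real.exp_pos _).le) (fun x => ?_)
    ((summable_prod_apply (fun n => (Real.exp_pos _).le) summable_exp_neg_abs_int).mul_left
      (Real.exp ((K * (a + n)) ^ 2 / 4)))
  rw [← Real.exp_sum, ← Real.exp_add, Real.exp_le_exp, Finset.sum_neg_distrib]
  set y : ι → ℝ := fun s => (x s : ℝ)
  have hsum : ∑ s, |(x s : ℝ)| ≤ n * ‖y‖ := by
    calc ∑ s, |(x s : ℝ)| ≤ ∑ _s : ι, ‖y‖ := Finset.sum_le_sum fun s _ => norm_le_pi_norm y s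
      _ = n * ‖y‖ := by simp [n]
  have h1 : (‖y‖ / K) ^ 2 ≤ ‖T y‖ ^ 2 := by
    gcongr
    rw [div_le_iff₀ hK', mul_comm]
    exact hle y
  have h2 : (a + n) * ‖y‖ ≤ (K * (a + n)) ^ 2 / 4 + (‖y‖ / K) ^ 2 := by
    have : (a + n) * ‖y‖ = K * (a + n) * (‖y‖ / K) := by field_simp
    rw [this]
    nlinarith [sq_nonneg (K * (a + n) / 2 - ‖y‖ / K)]
  linarith

/-- The half-open unit box of `ℝ^ι` with corner `x`. -/
def unitBox {ι : Type*} (x : ι → ℝ) : Set (ι → ℝ) := {v | ∀ s, v s ∈ Set.Ioc (x s) (x s + 1)}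

theorem unitBox_eq_pi {ι : Type*} (x : ι → ℝ) :
    unitBox x = Set.univ.pi fun s => Set.Ioc (x s) (x s + 1) := by
  ext v; simp [unitBox]

theorem measurableSet_unitBox {ι : Type*} [Fintype ι] (x : ι → ℝ) : MeasurableSet (unitBox x) := by
  rw [unitBox_eq_pi]
  exact MeasurableSet.univ_pi fun s => measurableSet_Ioc

theorem volume_unitBox {ι : Type*} [Fintype ι] (x : ι → ℝ) :
    MeasureTheory.volume (unitBox x) = 1 := by
  rw [unitBox_eq_pi, MeasureTheory.volume_pi_pi]
  simp

/-- Integrals over `ℝ^ι` unfold into sums over integer translates of the unit box. -/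
theorem hasSum_setIntegral_unitBox {ι : Type*} [Fintype ι] {g : (ι → ℝ) → ℂ}
    (hg : MeasureTheory.Integrable g) :
    HasSum (fun x : ι → ℤ => ∫ v in unitBox 0, g (v + fun s => (x s : ℝ))) (∫ v, g v) := by
  have hU : (⋃ x : ι → ℤ, unitBox fun s => (x s : ℝ)) = Set.univ := by
    refine Set.eq_univ_of_forall fun v => Set.mem_iUnion.2 ⟨fun s => ⌈v s⌉ - 1, fun s => ?_⟩
    have h1 := Int.le_ceil (v s)
    have h2 := Int.ceil_lt_add_one (v s)
    constructor <;> push_cast <;> linarith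
  have hd : Pairwise (Function.onFun Disjoint
      fun x : ι → ℤ => unitBox fun s => (x s : ℝ)) := by
    intro x y hxy
    refine Set.disjoint_left.2 fun v hx hy => hxy (funext fun s => ?_)
    obtain ⟨h1, h2⟩ := hx s
    obtain ⟨h3, h4⟩ := hy s
    have h5 : (x s : ℝ) < y s + 1 := h1.trans_le h4
    have h6 : (y s : ℝ) < x s + 1 := h3.trans_le h2
    have h7 : x s < y s + 1 := by exact_mod_cast h5
    have h8 : y s < x s + 1 := by exact_mod_cast h6
    omega
  have := MeasureTheory.hasSum_integral_iUnion (μ := MeasureTheory.volume) (f := g)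
    (fun x : ι → ℤ => measurableSet_unitBox fun s => (x s : ℝ)) hd hg.integrableOn
  rw [hU, MeasureTheory.setIntegral_univ] at this
  refine this.congr_fun fun x => ?_
  have h := (MeasureTheory.measurePreserving_add_right MeasureTheory.volume
    fun s => (x s : ℝ)).setIntegral_preimage_emb (MeasurableEquiv.addRight _).measurableEmbedding g
    (unitBox fun s => (x s : ℝ))
  rw [← h]
  congr 2
  ext v
  refine forall_congr' fun s => ?_
  simp only [Pi.zero_apply, Pi.add_apply, Set.mem_Ioc]
  constructor <;> rintro ⟨h1, h2⟩ <;> constructor <;> linarith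

/-- The additive character of `ℝ^ι` with integer frequency `m`. -/
noncomputable def intChar {ι : Type*} [Fintype ι] (m : ι → ℤ) (v : ι → ℝ) : ℂ :=
  Complex.exp ((2 * Real.pi * ∑ s, (m s : ℝ) * v s : ℝ) * Complex.I)

theorem mFourier_coe {ι : Type*} [Fintype ι] (m : ι → ℤ) (v : ι → ℝ) :
    UnitAddTorus.mFourier m (fun s => (v s : UnitAddCircle)) = intChar m v := by
  simp only [UnitAddTorus.mFourier, ContinuousMap.coe_mk, fourier_coe_apply, intChar,
    ← Complex.exp_sum]
  congr 1
  push_cast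
  rw [Finset.mul_sum, Finset.sum_mul]
  refine Finset.sum_congr rfl fun s _ => ?_
  ring

theorem norm_intChar {ι : Type*} [Fintype ι] (m : ι → ℤ) (v : ι → ℝ) : ‖intChar m v‖ = 1 :=
  Complex.norm_exp_ofReal_mul_I _

theorem continuous_intChar {ι : Type*} [Fintype ι] (m : ι → ℤ) : Continuous (intChar m) := by
  unfold intChar; fun_prop

theorem intChar_add_int {ι : Type*} [Fintype ι] (m : ι → ℤ) (v : ι → ℝ) (x : ι → ℤ) :
    intChar m (v + fun s => (x s : ℝ)) = intChar m v := by
  unfold intChar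
  rw [Complex.exp_eq_exp_iff_exists_int]
  refine ⟨∑ s, m s * x s, ?_⟩
  push_cast
  simp only [Pi.add_apply, Complex.ofReal_add, mul_add, Finset.sum_add_distrib]
  push_cast
  ring

/-- Poisson summation over the integer lattice of `ℝ^ι`. -/
theorem tsum_eq_tsum_integral_intChar {ι : Type*} [Fintype ι] {f : (ι → ℝ) → ℂ}
    (hc : Continuous f) (hf : MeasureTheory.Integrable f)
    (hb : ∀ R : ℝ, ∃ u : (ι → ℤ) → ℝ, Summable u ∧
      ∀ (x : ι → ℤ) (y : ι → ℝ), ‖y‖ ≤ R → ‖f (y + fun s => (x s : ℝ))‖ ≤ u x)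
    (hs : Summable fun m : ι → ℤ => ∫ v, intChar (-m) v * f v) (y : ι → ℝ) :
    ∑' x : ι → ℤ, f (y + fun s => (x s : ℝ)) =
      ∑' m : ι → ℤ, (∫ v, intChar (-m) v * f v) * intChar m y := by
  set F : (ι → ℝ) → ℂ := fun y => ∑' x : ι → ℤ, f (y + fun s => (x s : ℝ)) with hF
  have hFc : Continuous F := by
    rw [continuous_iff_continuousAt]
    intro y
    obtain ⟨u, hu, hle⟩ := hb (‖y‖ + 1)
    have : ContinuousOn F (Metric.ball y 1) := by
      refine continuousOn_tsum (fun x => (by fun_prop : Continuous _).continuousOn) hu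
        fun x z hz => hle x z ?_
      have h1 := norm_sub_norm_le z y
      rw [Metric.mem_ball, dist_eq_norm] at hz
      linarith
    exact this.continuousAt (Metric.ball_mem_nhds y one_pos)
  have hFp : ∀ (y : ι → ℝ) (x : ι → ℤ), F (y + fun s => (x s : ℝ)) = F y := by
    intro y x
    simp only [hF]
    rw [← (Equiv.addLeft x).tsum_eq fun z : ι → ℤ => f (y + fun s => (z s : ℝ))]
    refine tsum_congr fun z => congrArg f ?_
    ext s
    simp [add_assoc]
  let q : C((ι → ℝ), UnitAddTorus ι) := ⟨fun v s => (v s : UnitAddCircle), by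
    refine continuous_pi fun s => ?_
    exact (AddCircle.continuous_mk' 1).comp (continuous_apply s)⟩
  have hq : Topology.IsQuotientMap q :=
    (IsOpenQuotientMap.piMap fun _ : ι =>
      (QuotientAddGroup.isOpenQuotientMap_mk (N := AddSubgroup.zmultiples (1 : ℝ)))).isQuotientMap
  have hfac : Function.FactorsThrough (⟨F, hFc⟩ : C((ι → ℝ), ℂ)) q := by
    intro a b hab
    have h1 : ∀ s, ∃ n : ℤ, b s = a s + n := by
      intro s
      have h2 : ((a s : ℝ) : UnitAddCircle) = (b s : UnitAddCircle) := congrFun hab s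
      rw [eq_comm, ← sub_eq_zero, ← AddCircle.coe_sub, AddCircle.coe_eq_zero_iff] at h2
      obtain ⟨n, hn⟩ := h2
      exact ⟨n, by rw [zsmul_one] at hn; linarith⟩
    choose n hn using h1
    change F a = F b
    rw [← hFp a n]
    congr 1
    ext s
    simp [hn s]
  let F' : C(UnitAddTorus ι, ℂ) := hq.lift ⟨F, hFc⟩ hfac
  have hF' : ∀ v, F' (q v) = F v := fun v =>
    congrArg (fun g : C((ι → ℝ), ℂ) => g v) (hq.lift_comp ⟨F, hFc⟩ hfac)
  have hcoef : ∀ m, UnitAddTorus.mFourierCoeff F' m = ∫ v, intChar (-m) v * f v := by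
    intro m
    set g : (ι → ℝ) → ℂ := fun v => intChar (-m) v * f v with hg
    have hgc : Continuous g := (continuous_intChar _).mul hc
    have hgn : ∀ v, ‖g v‖ = ‖f v‖ := fun v => by simp [hg, norm_intChar]
    have hgi : MeasureTheory.Integrable g :=
      hf.mono hgc.aestronglyMeasurable (Filter.Eventually.of_forall fun v => (hgn v).le)
    rw [UnitAddTorus.mFourierCoeff_eq_integral _ _ 0, ← (hasSum_setIntegral_unitBox hgi).tsum_eq,
      MeasureTheory.integral_tsum_of_summable_integral_norm]
    · refine MeasureTheory.integral_congr_ae (Filter.Eventually.of_forall fun v => ?_)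
      change UnitAddTorus.mFourier (-m) (q v) • F' (q v) = _
      rw [hF', hF, smul_eq_mul, ← tsum_mul_left]
      refine tsum_congr fun x => ?_
      simp only [hg, intChar_add_int]
      congr 1
      exact mFourier_coe _ _
    · intro x
      exact ((hgi.comp_add_right _).integrableOn : MeasureTheory.IntegrableOn _ (unitBox 0) _)
    · obtain ⟨u, hu, hle⟩ := hb 1
      refine Summable.of_nonneg_of_le
        (fun x => MeasureTheory.integral_nonneg fun v => norm_nonneg _) (fun x => ?_) hu
      have h1 : ∀ v ∈ unitBox (0 : ι → ℝ), ‖‖g (v + fun s => (x s : ℝ))‖‖ ≤ u x := by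
        intro v hv
        rw [norm_norm, hgn]
        refine hle x v ((pi_norm_le_iff_of_nonneg zero_le_one).2 fun s => ?_)
        have := hv s
        simp only [Pi.zero_apply, zero_add, Set.mem_Ioc] at this
        rw [Real.norm_eq_abs, abs_le]
        constructor <;> linarith
      have := MeasureTheory.norm_setIntegral_le_of_norm_le_const
        (μ := MeasureTheory.volume) (by rw [volume_unitBox]; exact ENNReal.one_lt_top) h1
      rw [MeasureTheory.measureReal_def, volume_unitBox] at this
      simpa using (le_abs_self _).trans this
  have hsum : Summable (UnitAddTorus.mFourierCoeff F') := by
    rw [show UnitAddTorus.mFourierCoeff F' = _ from funext hcoef]; exact hs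
  have := (UnitAddTorus.hasSum_mFourier_series_apply_of_summable hsum (q y)).tsum_eq
  rw [hF'] at this
  refine Eq.trans this.symm (tsum_congr fun m => ?_)
  rw [hcoef, smul_eq_mul, ← mFourier_coe]
  rfl

/-- The Fourier transform of a Gaussian on `ℝ^ι` given by a linear equivalence. -/
theorem exists_integral_intChar_gauss {ι V : Type*} [Fintype ι] [NormedAddCommGroup V]
    [InnerProductSpace ℝ V] [FiniteDimensional ℝ V] [MeasurableSpace V] [BorelSpace V]
    (e : (ι → ℝ) ≃L[ℝ] V) :
    MeasureTheory.Integrable (fun v : ι → ℝ => Complex.exp (-(‖e v‖ : ℂ) ^ 2)) ∧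
    ∃ C : ℝ, 0 < C ∧ ∀ (m : ι → ℤ) (y : ι → ℝ),
      (∀ v, inner ℝ (e y) (e v) = Real.pi * ∑ s, (m s : ℝ) * v s) →
      ∫ v, intChar (-m) v * Complex.exp (-(‖e v‖ : ℂ) ^ 2) =
        ((C * Real.exp (-‖e y‖ ^ 2) : ℝ) : ℂ) := by
  let μ : MeasureTheory.Measure V := MeasureTheory.Measure.map e MeasureTheory.volume
  have : μ.IsAddHaarMeasure := e.isAddHaarMeasure_map _
  let c := μ.addHaarScalarFactor MeasureTheory.volume
  have hμ : μ = c • MeasureTheory.volume :=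
    MeasureTheory.Measure.isAddLeftInvariant_eq_smul _ _
  have hc : 0 < c := MeasureTheory.Measure.addHaarScalarFactor_pos_of_isAddHaarMeasure _ _
  let e' : (ι → ℝ) ≃ᵐ V := e.toHomeomorph.toMeasurableEquiv
  have hμ' : MeasureTheory.Measure.map e' MeasureTheory.volume = c • MeasureTheory.volume := hμ
  have hcov : ∀ g : V → ℂ, ∫ v, g (e v) = (c : ℝ) * ∫ w, g w := by
    intro g
    have := MeasureTheory.integral_map_equiv (μ := MeasureTheory.volume) e' g
    rw [hμ', MeasureTheory.integral_smul_nnreal_measure] at this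
    exact this.symm
  refine ⟨?_, c * Real.pi ^ ((Module.finrank ℝ V : ℝ) / 2), by positivity, fun m y hy => ?_⟩
  · have h1 := GaussianFourier.integrable_cexp_neg_mul_sq_norm_add (V := V) (b := 1)
      (by norm_num) 0 0
    have h2 := (MeasureTheory.integrable_map_equiv (μ := MeasureTheory.volume) e' _).1
      (hμ'.symm ▸ h1.smul_measure_nnreal (c := c))
    refine h2.congr (Filter.Eventually.of_forall fun v => ?_)
    simp [e']
  · have h1 : ∀ v, intChar (-m) v * Complex.exp (-(‖e v‖ : ℂ) ^ 2) =
        Complex.exp (-1 * (‖e v‖ : ℂ) ^ 2 + (-2 * Complex.I) * (inner ℝ (e y) (e v) : ℝ)) := by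
      intro v
      rw [hy, intChar, ← Complex.exp_add]
      congr 1
      simp only [Pi.neg_apply, Int.cast_neg, neg_mul, Finset.sum_neg_distrib]
      push_cast
      ring
    simp_rw [h1]
    rw [hcov fun w => Complex.exp (-1 * (‖w‖ : ℂ) ^ 2 + (-2 * Complex.I) * (inner ℝ (e y) w : ℝ)),
      GaussianFourier.integral_cexp_neg_mul_sq_norm_add (by norm_num)]
    push_cast
    rw [Complex.ofReal_cpow Real.pi_pos.le]
    push_cast
    rw [div_one, mul_assoc]
    congr 3
    rw [mul_pow, Complex.I_sq]
    ring

/-- Poisson summation for Gaussian sums over the integer lattice: `S` encodes the dual form. -/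
theorem exists_tsum_gauss_eq {ι E : Type*} [Fintype ι] [NormedAddCommGroup E]
    [InnerProductSpace ℝ E] (T : (ι → ℝ) →ₗ[ℝ] E) (hT : Function.Injective T)
    (S : (ι → ℝ) →ₗ[ℝ] ι → ℝ)
    (hS : ∀ m y : ι → ℝ, inner ℝ (T (S m)) (T y) = Real.pi * ∑ s, m s * y s) :
    ∃ C : ℝ, 0 < C ∧ ∀ y : ι → ℝ,
      ∑' x : ι → ℤ, Real.exp (-‖T (y + fun s => (x s : ℝ))‖ ^ 2) =
        C * ∑' m : ι → ℤ, Real.exp (-‖T (S fun s => (m s : ℝ))‖ ^ 2) *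
          Real.cos (2 * Real.pi * ∑ s, (m s : ℝ) * y s) := by
  let V := LinearMap.range T
  let _ : MeasurableSpace V := borel V
  have : BorelSpace V := ⟨rfl⟩
  let e : (ι → ℝ) ≃L[ℝ] V := (LinearEquiv.ofInjective T hT).toContinuousLinearEquiv
  have hen : ∀ v, ‖e v‖ = ‖T v‖ := fun v => rfl
  have hei : ∀ v w, inner ℝ (e v) (e w) = inner ℝ (T v) (T w) := fun v w => rfl
  have hSinj : Function.Injective S := by
    rw [← LinearMap.ker_eq_bot, LinearMap.ker_eq_bot']
    intro m hm
    have := hS m m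
    rw [hm, map_zero, inner_zero_left, zero_eq_mul] at this
    have h2 := (Finset.sum_eq_zero_iff_of_nonneg fun s _ => mul_self_nonneg (m s)).1
      (this.resolve_left Real.pi_ne_zero)
    exact funext fun s => mul_self_eq_zero.1 (h2 s (Finset.mem_univ s))
  obtain ⟨hfi, C, hC, hI⟩ := exists_integral_intChar_gauss e
  have hI' : ∀ m : ι → ℤ, ∫ v, intChar (-m) v * Complex.exp (-(‖e v‖ : ℂ) ^ 2) =
      ((C * Real.exp (-‖T (S fun s => (m s : ℝ))‖ ^ 2) : ℝ) : ℂ) := fun m =>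
    hI m (S fun s => (m s : ℝ)) fun v => by rw [hei, hS]
  have hsm : Summable fun m : ι → ℤ => Real.exp (-‖T (S fun s => (m s : ℝ))‖ ^ 2) := by
    simpa using summable_exp_neg_norm_sq_add (T ∘ₗ S) (hT.comp hSinj) 0
  refine ⟨C, hC, fun y => ?_⟩
  have key := tsum_eq_tsum_integral_intChar (f := fun v => Complex.exp (-(‖e v‖ : ℂ) ^ 2))
    (by fun_prop) hfi (fun R => ?_) (by
      simp_rw [hI']
      exact Complex.hasSum_ofReal.2 (hsm.mul_left C).hasSum |>.summable) y
  · simp_rw [hI'] at key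
    have hterm : ∀ v : ι → ℝ, Complex.exp (-(‖e v‖ : ℂ) ^ 2) =
        ((Real.exp (-‖T v‖ ^ 2) : ℝ) : ℂ) := fun v => by
      rw [hen]; push_cast; rfl
    simp_rw [hterm] at key
    rw [← Complex.ofReal_tsum] at key
    have hre := congrArg Complex.re key
    rw [Complex.ofReal_re, Complex.re_tsum] at hre
    · rw [hre, ← tsum_mul_left]
      refine tsum_congr fun m => ?_
      rw [Complex.re_ofReal_mul, intChar, Complex.exp_ofReal_mul_I_re, mul_assoc]
    · refine Summable.of_norm_bounded (hsm.mul_left C) fun m => ?_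
      rw [norm_mul, norm_intChar, mul_one, Complex.norm_real, Real.norm_of_nonneg (by positivity)]
  · set κ := ‖(e : (ι → ℝ) →L[ℝ] V)‖
    refine ⟨_, summable_exp_neg_norm_sq_add T hT (2 * (κ * (κ * R))), fun x y hy => ?_⟩
    rw [← Complex.ofReal_pow, ← Complex.ofReal_neg, ← Complex.ofReal_exp, Complex.norm_real,
      Real.norm_of_nonneg (Real.exp_pos _).le, Real.exp_le_exp, hen, map_add]
    set z : ι → ℝ := fun s => (x s : ℝ)
    have h1 : ‖T y‖ ≤ κ * R :=
      ((e : (ι → ℝ) →L[ℝ] V).le_opNorm y).trans (by gcongr)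
    have h2 : ‖T z‖ ≤ κ * ‖z‖ := (e : (ι → ℝ) →L[ℝ] V).le_opNorm z
    have h3 : ‖T z‖ * ‖T y‖ ≤ κ * ‖z‖ * (κ * R) := by gcongr
    have h4 := abs_real_inner_le_norm (T y) (T z)
    have h5 := norm_add_sq_real (T y) (T z)
    have h6 := neg_abs_le (inner ℝ (T y) (T z))
    nlinarith [sq_nonneg ‖T y‖]

theorem abs_sinh_le (x : ℝ) : |Real.sinh x| ≤ |x| * Real.exp |x| := by
  have key : ∀ y : ℝ, 0 ≤ y → Real.sinh y ≤ y * Real.exp y := by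
    intro y _
    have h1 := Real.add_one_le_exp (-(2 * y))
    have h2 : Real.exp y * Real.exp (-(2 * y)) = Real.exp (-y) := by
      rw [← Real.exp_add]; congr 1; ring
    rw [Real.sinh_eq]
    nlinarith [Real.exp_pos y]
  rw [Real.abs_sinh]
  exact key _ (abs_nonneg x)

theorem tendsto_sinh_mul_div (a : ℝ) :
    Tendsto (fun s : ℝ => Real.sinh (s * a) / s) (nhdsWithin 0 {0}ᶜ) (nhds a) := by
  have h : HasDerivAt (fun s : ℝ => Real.sinh (s * a)) a 0 := by
    simpa using ((hasDerivAt_id (0 : ℝ)).mul_const a).sinh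
  simpa [div_eq_inv_mul] using h.tendsto_slope_zero

theorem tendsto_sin_mul_div (a : ℝ) :
    Tendsto (fun s : ℝ => Real.sin (s * a) / s) (nhdsWithin 0 {0}ᶜ) (nhds a) := by
  have h : HasDerivAt (fun s : ℝ => Real.sin (s * a)) a 0 := by
    simpa using ((hasDerivAt_id (0 : ℝ)).mul_const a).sin
  simpa [div_eq_inv_mul] using h.tendsto_slope_zero

theorem tendsto_exp_sq_mul_sub_one_div (q : ℝ) :
    Tendsto (fun s : ℝ => (Real.exp (s ^ 2 * q) - 1) / s ^ 2) (nhdsWithin 0 {0}ᶜ) (nhds q) := by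
  have h : HasDerivAt (fun s : ℝ => Real.exp (s * q)) q 0 := by
    simpa using ((hasDerivAt_id (0 : ℝ)).mul_const q).exp
  have h2 : Tendsto (fun s : ℝ => s ^ 2) (nhdsWithin 0 {0}ᶜ) (nhdsWithin 0 {0}ᶜ) := by
    refine tendsto_nhdsWithin_iff.2 ⟨?_, ?_⟩
    · refine Tendsto.mono_left ?_ nhdsWithin_le_nhds
      simpa using (continuous_pow 2).tendsto (0 : ℝ)
    · filter_upwards [self_mem_nhdsWithin] with s hs
      exact pow_ne_zero 2 hs
  simpa [div_eq_inv_mul, Function.comp_def] using h.tendsto_slope_zero.comp h2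

theorem sq_le_exp_two_mul_abs (x : ℝ) : x ^ 2 ≤ Real.exp (2 * |x|) := by
  have h := Real.add_one_le_exp |x|
  have h2 : Real.exp (2 * |x|) = Real.exp |x| ^ 2 := by rw [← Real.exp_nat_mul]; norm_num
  rw [h2, ← sq_abs]
  gcongr
  linarith

theorem sq_sinh_mul_div_le {s a : ℝ} (hs : |s| ≤ 1) :
    (Real.sinh (s * a) / s) ^ 2 ≤ Real.exp (4 * |a|) := by
  have h1 : |Real.sinh (s * a) / s| ≤ |a| * Real.exp |a| := by
    rcases eq_or_ne s 0 with rfl | h0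
    · simpa using by positivity
    rw [abs_div, div_le_iff₀ (abs_pos.2 h0)]
    have h2 : |s * a| ≤ |a| := by rw [abs_mul]; nlinarith [abs_nonneg a]
    calc |Real.sinh (s * a)| ≤ |s * a| * Real.exp |s * a| := abs_sinh_le _
      _ ≤ |s * a| * Real.exp |a| := by gcongr
      _ = |a| * Real.exp |a| * |s| := by rw [abs_mul]; ring
  have h3 := sq_le_exp_two_mul_abs a
  have h4 : Real.exp (4 * |a|) = Real.exp (2 * |a|) * Real.exp |a| ^ 2 := by
    rw [← Real.exp_nat_mul, ← Real.exp_add]; congr 1; push_cast; ring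
  rw [← sq_abs, h4]
  calc |Real.sinh (s * a) / s| ^ 2 ≤ (|a| * Real.exp |a|) ^ 2 := by gcongr
    _ = a ^ 2 * Real.exp |a| ^ 2 := by rw [mul_pow, sq_abs]
    _ ≤ _ := by gcongr

theorem sq_sin_mul_div_le (s a : ℝ) : (Real.sin (s * a) / s) ^ 2 ≤ a ^ 2 := by
  rcases eq_or_ne s 0 with rfl | h0
  · simpa using sq_nonneg a
  rw [div_pow, div_le_iff₀ (by positivity)]
  have := Real.abs_sin_le_abs (x := s * a)
  calc Real.sin (s * a) ^ 2 ≤ (s * a) ^ 2 := sq_le_sq.2 this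
    _ = a ^ 2 * s ^ 2 := by ring

/-- A linear functional times a Gaussian is exponentially integrable over the lattice. -/
theorem summable_gauss_mul_exp_abs {ι E : Type*} [Fintype ι] [NormedAddCommGroup E]
    [InnerProductSpace ℝ E] (T : (ι → ℝ) →ₗ[ℝ] E) (hT : Function.Injective T)
    (l : (ι → ℝ) →ₗ[ℝ] ℝ) : Summable fun x : ι → ℤ =>
      Real.exp (-‖T fun s => (x s : ℝ)‖ ^ 2) * Real.exp |l fun s => (x s : ℝ)| := by
  refine Summable.of_nonneg_of_le (fun x => by positivity) (fun x => ?_)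
    (summable_exp_neg_norm_sq_add T hT ‖LinearMap.toContinuousLinearMap l‖)
  rw [← Real.exp_add, Real.exp_le_exp]
  gcongr
  exact (LinearMap.toContinuousLinearMap l).le_opNorm _

theorem summable_sq_mul_gauss {ι E : Type*} [Fintype ι] [NormedAddCommGroup E]
    [InnerProductSpace ℝ E] (T : (ι → ℝ) →ₗ[ℝ] E) (hT : Function.Injective T)
    (l : (ι → ℝ) →ₗ[ℝ] ℝ) : Summable fun x : ι → ℤ =>
      (l fun s => (x s : ℝ)) ^ 2 * Real.exp (-‖T fun s => (x s : ℝ)‖ ^ 2) := by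
  refine Summable.of_nonneg_of_le (fun x => by positivity) (fun x => ?_)
    (summable_gauss_mul_exp_abs T hT ((2 : ℝ) • l))
  rw [mul_comm]
  gcongr
  refine (sq_le_exp_two_mul_abs _).trans_eq ?_
  simp [abs_mul]

/-- Duality of second moments for lattice Gaussian sums, by expanding the Poisson summation
formula to second order. -/
theorem gauss_duality_second_moment {ι E : Type*} [Fintype ι] [NormedAddCommGroup E]
    [InnerProductSpace ℝ E] (T : (ι → ℝ) →ₗ[ℝ] E) (hT : Function.Injective T)
    (S : (ι → ℝ) →ₗ[ℝ] ι → ℝ)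
    (hS : ∀ m y : ι → ℝ, inner ℝ (T (S m)) (T y) = Real.pi * ∑ s, m s * y s) (ψ : ι → ℝ) :
    (∑' m : ι → ℤ, (2 * Real.pi * ∑ s, (m s : ℝ) * ψ s) ^ 2 *
        Real.exp (-‖T (S fun s => (m s : ℝ))‖ ^ 2)) /
      (∑' m : ι → ℤ, Real.exp (-‖T (S fun s => (m s : ℝ))‖ ^ 2)) =
    2 * ‖T ψ‖ ^ 2 - 4 *
      ((∑' x : ι → ℤ, inner ℝ (T ψ) (T fun s => (x s : ℝ)) ^ 2 *
        Real.exp (-‖T fun s => (x s : ℝ)‖ ^ 2)) /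
      ∑' x : ι → ℤ, Real.exp (-‖T fun s => (x s : ℝ)‖ ^ 2)) := by
  obtain ⟨C, hC, hP⟩ := exists_tsum_gauss_eq T hT S hS
  have hSinj : Function.Injective S := by
    rw [← LinearMap.ker_eq_bot, LinearMap.ker_eq_bot']
    intro m hm
    have := hS m m
    rw [hm, map_zero, inner_zero_left, zero_eq_mul] at this
    have h2 := (Finset.sum_eq_zero_iff_of_nonneg fun s _ => mul_self_nonneg (m s)).1
      (this.resolve_left Real.pi_ne_zero)
    exact funext fun s => mul_self_eq_zero.1 (h2 s (Finset.mem_univ s))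
  set q := ‖T ψ‖ ^ 2
  let Dl : (ι → ℝ) →ₗ[ℝ] ℝ := (innerₗ E (T ψ)) ∘ₗ T
  let Ul : (ι → ℝ) →ₗ[ℝ] ℝ := (2 * Real.pi) • ∑ s, ψ s • LinearMap.proj s
  have hUl : ∀ m : ι → ℝ, Ul m = 2 * Real.pi * ∑ s, m s * ψ s := fun m => by
    simp [Ul, mul_comm]
  set W : (ι → ℤ) → ℝ := fun x => Real.exp (-‖T fun s => (x s : ℝ)‖ ^ 2) with hW
  set w : (ι → ℤ) → ℝ := fun m => Real.exp (-‖T (S fun s => (m s : ℝ))‖ ^ 2) with hw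
  set D : (ι → ℤ) → ℝ := fun x => inner ℝ (T ψ) (T fun s => (x s : ℝ)) with hD
  set U : (ι → ℤ) → ℝ := fun m => 2 * Real.pi * ∑ s, (m s : ℝ) * ψ s with hU
  have hW0 : ∀ x, 0 < W x := fun x => Real.exp_pos _
  have hw0 : ∀ x, 0 < w x := fun x => Real.exp_pos _
  have sW : Summable W := by simpa using summable_exp_neg_norm_sq_add T hT 0
  have sw : Summable w := by simpa using summable_exp_neg_norm_sq_add (T ∘ₗ S) (hT.comp hSinj) 0
  have sUw : Summable fun m => U m ^ 2 * w m := by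
    have := summable_sq_mul_gauss (T ∘ₗ S) (hT.comp hSinj) Ul
    simp_rw [hUl] at this
    exact this
  have sWD : ∀ c : ℝ, Summable fun x => W x * Real.exp (|c * D x|) := fun c =>
    summable_gauss_mul_exp_abs T hT (c • Dl)
  have hZ : ∑' x, W x = C * ∑' m, w m := by
    have := hP 0
    simpa using this
  have hpos : 0 < ∑' m, w m := sw.tsum_pos (fun m => (hw0 m).le) 0 (hw0 0)
  have sexp : ∀ c : ℝ, Summable fun x => W x * Real.exp (c * D x) := fun c =>
    Summable.of_nonneg_of_le (fun x => by positivity)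
      (fun x => mul_le_mul_of_nonneg_left (Real.exp_le_exp.2 (le_abs_self _)) (hW0 x).le) (sWD c)
  have hs1 : ∀ s : ℝ, ∑' x, W x * Real.exp (-2 * s * D x) =
      Real.exp (s ^ 2 * q) * (C * ∑' m, w m * Real.cos (s * U m)) := by
    intro s
    have h := hP (s • ψ)
    have e1 : ∀ x : ι → ℤ, Real.exp (-‖T (s • ψ + fun i => (x i : ℝ))‖ ^ 2) =
        Real.exp (-(s ^ 2 * q)) * (W x * Real.exp (-2 * s * D x)) := by
      intro x
      rw [map_add, map_smul, norm_add_sq_real, norm_smul, inner_smul_left, ← Real.exp_add,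
        ← Real.exp_add, mul_pow, Real.norm_eq_abs, sq_abs]
      congr 1
      simp only [hD, q, conj_trivial]
      ring
    have e2 : ∀ m : ι → ℤ, 2 * Real.pi * ∑ i, (m i : ℝ) * (s • ψ) i = s * U m := by
      intro m
      simp only [hU, Pi.smul_apply, smul_eq_mul, mul_left_comm _ s, ← Finset.mul_sum]
    simp_rw [e1, e2] at h
    rw [tsum_mul_left] at h
    rw [← h, ← mul_assoc, ← Real.exp_add]
    simp
  have hid : ∀ s : ℝ, s ≠ 0 → 2 * ∑' x, W x * (Real.sinh (s * D x) / s) ^ 2 =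
      (C * ∑' m, w m) * ((Real.exp (s ^ 2 * q) - 1) / s ^ 2) -
      Real.exp (s ^ 2 * q) * (C * (2 * ∑' m, w m * (Real.sin (s * (U m / 2)) / s) ^ 2)) := by
    intro s h0
    have h1 : (∑' x, W x * Real.exp (-2 * s * D x)) + ∑' x, W x * Real.exp (2 * s * D x) =
        2 * (∑' x, W x) + 4 * s ^ 2 * ∑' x, W x * (Real.sinh (s * D x) / s) ^ 2 := by
      have hterm : ∀ x, W x * Real.exp (-2 * s * D x) + W x * Real.exp (2 * s * D x) =
          2 * W x + 4 * s ^ 2 * (W x * (Real.sinh (s * D x) / s) ^ 2) := by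
        intro x
        have h2 : Real.sinh (s * D x) ^ 2 =
            (Real.exp (-2 * s * D x) + Real.exp (2 * s * D x) - 2) / 4 := by
          have h3 := Real.cosh_two_mul (s * D x)
          rw [Real.cosh_sq, Real.cosh_eq] at h3
          rw [show -2 * s * D x = -(2 * (s * D x)) by ring, mul_assoc 2 s]
          linarith
        generalize W x = a
        rw [div_pow, h2]
        field_simp
        ring
      have hsum : Summable fun x => W x * (Real.sinh (s * D x) / s) ^ 2 := by
        have h2 := (((sexp (-2 * s)).add (sexp (2 * s))).sub (sW.mul_left 2)).mul_left
          (4 * s ^ 2)⁻¹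
        refine h2.congr fun x => ?_
        rw [hterm]
        field_simp
        ring
      rw [← (sexp (-2 * s)).tsum_add (sexp (2 * s)), tsum_congr hterm,
        (sW.mul_left 2).tsum_add (hsum.mul_left _), tsum_mul_left, tsum_mul_left]
    have h2 : ∑' m, w m * Real.cos (s * U m) =
        (∑' m, w m) - 2 * s ^ 2 * ∑' m, w m * (Real.sin (s * (U m / 2)) / s) ^ 2 := by
      have hsum : Summable fun m => w m * (Real.sin (s * (U m / 2)) / s) ^ 2 := by
        refine Summable.of_nonneg_of_le (fun m => by have := hw0 m; positivity) (fun m => ?_)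
          (sUw.mul_left (1 / 4))
        have := mul_le_mul_of_nonneg_left (sq_sin_mul_div_le s (U m / 2)) (hw0 m).le
        linarith
      rw [← tsum_mul_left, ← sw.tsum_sub (hsum.mul_left _)]
      refine tsum_congr fun m => ?_
      rw [show s * U m = 2 * (s * (U m / 2)) by ring, Real.cos_two_mul, Real.cos_sq']
      field_simp
      ring
    have h3 := hs1 s
    have h4 := hs1 (-s)
    simp only [neg_mul, mul_neg, neg_neg, neg_sq, Real.cos_neg] at h3 h4 h1
    rw [h3, h4, h2, hZ] at h1
    generalize ∑' x, W x * (Real.sinh (s * D x) / s) ^ 2 = A at h1 ⊢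
    generalize ∑' m, w m * (Real.sin (s * (U m / 2)) / s) ^ 2 = B at h1 ⊢
    generalize ∑' m, w m = z at h1 ⊢
    field_simp
    linarith
  have hev : ∀ᶠ s : ℝ in nhdsWithin 0 {0}ᶜ, |s| ≤ 1 := by
    refine nhdsWithin_le_nhds ?_
    filter_upwards [Metric.ball_mem_nhds (0 : ℝ) one_pos] with s hs
    simpa using (Metric.mem_ball.1 hs).le
  have l1 : Tendsto (fun s : ℝ => 2 * ∑' x, W x * (Real.sinh (s * D x) / s) ^ 2)
      (nhdsWithin 0 {0}ᶜ) (nhds (2 * ∑' x, W x * D x ^ 2)) := by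
    refine Tendsto.const_mul 2 ?_
    refine tendsto_tsum_of_dominated_convergence (sWD 4)
      (fun x => ((tendsto_sinh_mul_div (D x)).pow 2).const_mul (W x)) ?_
    filter_upwards [hev] with s hs x
    have := hW0 x
    rw [Real.norm_of_nonneg (by positivity)]
    refine mul_le_mul_of_nonneg_left ((sq_sinh_mul_div_le hs).trans_eq ?_) this.le
    rw [abs_mul]; norm_num
  have l2 : Tendsto (fun s : ℝ => (C * ∑' m, w m) * ((Real.exp (s ^ 2 * q) - 1) / s ^ 2) -
      Real.exp (s ^ 2 * q) * (C * (2 * ∑' m, w m * (Real.sin (s * (U m / 2)) / s) ^ 2)))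
      (nhdsWithin 0 {0}ᶜ) (nhds ((C * ∑' m, w m) * q -
        Real.exp ((0 : ℝ) ^ 2 * q) * (C * (2 * ∑' m, w m * (U m / 2) ^ 2)))) := by
    refine ((tendsto_exp_sq_mul_sub_one_div q).const_mul _).sub (Tendsto.mul ?_
      ((Tendsto.const_mul 2 ?_).const_mul C))
    · exact ((by fun_prop : Continuous fun s : ℝ => Real.exp (s ^ 2 * q)).tendsto 0).mono_left
        nhdsWithin_le_nhds
    · refine tendsto_tsum_of_dominated_convergence (sUw.mul_left (1 / 4))
        (fun m => ((tendsto_sin_mul_div (U m / 2)).pow 2).const_mul (w m)) ?_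
      filter_upwards with s m
      have := hw0 m
      rw [Real.norm_of_nonneg (by positivity)]
      have := mul_le_mul_of_nonneg_left (sq_sin_mul_div_le s (U m / 2)) this.le
      linarith
  have hlim := tendsto_nhds_unique l1 (l2.congr' (by
    filter_upwards [self_mem_nhdsWithin] with s hs
    exact (hid s hs).symm))
  have e3 : ∑' m, w m * (U m / 2) ^ 2 = 1 / 4 * ∑' m, U m ^ 2 * w m := by
    rw [← tsum_mul_left]
    exact tsum_congr fun m => by ring
  have e4 : ∑' x, W x * D x ^ 2 = ∑' x, D x ^ 2 * W x := tsum_congr fun x => mul_comm _ _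
  rw [e3, e4] at hlim
  simp only [ne_eq, OfNat.ofNat_ne_zero, not_false_eq_true, zero_pow, zero_mul, Real.exp_zero,
    one_mul] at hlim
  have hX : ∑' x, D x ^ 2 * W x = C * ((∑' m, w m) * q / 2 - (∑' m, U m ^ 2 * w m) / 4) := by
    linarith
  change (∑' m, U m ^ 2 * w m) / (∑' m, w m) =
    2 * q - 4 * ((∑' x, D x ^ 2 * W x) / ∑' x, W x)
  rw [hX, hZ]
  generalize ∑' m, U m ^ 2 * w m = u
  generalize ∑' m, w m = z at hpos ⊢
  field_simp
  ring

theorem List.sum_count_mul {α : Type*} [Fintype α] [BEq α] [LawfulBEq α] (L : List α) (f : α → ℝ) :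
    ∑ a, (L.count a : ℝ) * f a = (L.map f).sum := by
  classical
  induction L with
  | nil => simp
  | cons b L ih =>
    simp [List.count_cons, add_mul, Finset.sum_add_distrib, ih, add_comm]

theorem srwKernel_mulVec (N : ℕ) [NeZero N] (f : Torus N → ℝ) (v : Torus N) :
    (srwKernel N).mulVec f v =
      (f (v + (1, 0)) + f (v - (1, 0)) + f (v + (0, 1)) + f (v - (0, 1))) / 4 := by
  have h := List.sum_count_mul (torusSteps N) fun s => f (v + s)
  have h2 : (srwKernel N).mulVec f v =
      (∑ s, ((torusSteps N).count s : ℝ) * f (v + s)) / 4 := by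
    rw [Matrix.mulVec, dotProduct, ← Equiv.sum_comp (Equiv.addLeft v), Finset.sum_div]
    refine Finset.sum_congr rfl fun s _ => ?_
    simp [srwKernel]
    ring
  rw [h2, h]
  have e1 : ((-1, 0) : Torus N) = -(1, 0) := by simp
  have e2 : ((0, -1) : Torus N) = -(0, 1) := by simp
  simp only [torusSteps, List.map_cons, List.map_nil, List.sum_cons, List.sum_nil, e1, e2,
    ← sub_eq_add_neg]
  ring

/-- Summation by parts on the torus. -/
theorem sum_grad_mul_grad (N : ℕ) [NeZero N] (f g : Torus N → ℝ) :
    ∑ e, grad f e * grad g e = 4 * ∑ v, f v * (g v - (srwKernel N).mulVec g v) := by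
  have hs : ∀ s : Torus N, ∑ v, (f (v + s) - f v) * (g (v + s) - g v) =
      ∑ v, f v * (2 * g v - g (v + s) - g (v - s)) := by
    intro s
    have h1 : ∑ v, f (v + s) * (g (v + s) - g v) = ∑ v, f v * (g v - g (v - s)) := by
      rw [← Equiv.sum_comp (Equiv.addRight s) fun v => f v * (g v - g (v - s))]
      simp
    have h2 : ∀ v, (f (v + s) - f v) * (g (v + s) - g v) =
        f (v + s) * (g (v + s) - g v) - f v * (g (v + s) - g v) := fun v => by ring
    simp_rw [h2]
    rw [Finset.sum_sub_distrib, h1, ← Finset.sum_sub_distrib]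
    exact Finset.sum_congr rfl fun v _ => by ring
  rw [Fintype.sum_prod_type_right]
  simp only [grad, Fintype.sum_bool, hs, edgeStep]
  rw [← Finset.sum_add_distrib, Finset.mul_sum]
  refine Finset.sum_congr rfl fun v _ => ?_
  rw [srwKernel_mulVec]
  ring

theorem srwKernel_transpose (N : ℕ) [NeZero N] : (srwKernel N).transpose = srwKernel N := by
  ext i j
  have h1 := sum_grad_mul_grad N (Pi.single i 1) (Pi.single j 1)
  have h2 := sum_grad_mul_grad N (Pi.single j 1) (Pi.single i 1)
  simp only [Pi.single_apply, ite_mul, one_mul, zero_mul, Finset.sum_ite_eq',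
    Finset.mem_univ, if_true] at h1 h2
  have h3 : ∑ e, grad (Pi.single i (1 : ℝ)) e * grad (Pi.single j (1 : ℝ)) e =
      ∑ e, grad (Pi.single j (1 : ℝ)) e * grad (Pi.single i (1 : ℝ)) e :=
    Finset.sum_congr rfl fun e _ => mul_comm _ _
  rw [h1, h2] at h3
  simp only [Matrix.mulVec_single_one, Matrix.col_apply, eq_comm (a := j) (b := i)] at h3
  rw [Matrix.transpose_apply]
  linarith

theorem srwKernel_nonneg (N : ℕ) (i j : Torus N) : 0 ≤ srwKernel N i j := by
  unfold srwKernel; positivity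

theorem sum_srwKernel (N : ℕ) [NeZero N] (i : Torus N) : ∑ j, srwKernel N i j = 1 := by
  have := srwKernel_mulVec N (fun _ => 1) i
  simp only [Matrix.mulVec, dotProduct, mul_one] at this
  rw [this]; norm_num

theorem srwKernel_pow_add (N : ℕ) [NeZero N] (a : Torus N) (t : ℕ) (i j : Torus N) :
    (srwKernel N ^ t) (i + a) (j + a) = (srwKernel N ^ t) i j := by
  induction t generalizing j with
  | zero => simp [Matrix.one_apply]
  | succ t ih =>
    rw [pow_succ, Matrix.mul_apply, Matrix.mul_apply, ← Equiv.sum_comp (Equiv.addRight a)]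
    refine Finset.sum_congr rfl fun k _ => ?_
    simp [ih, srwKernel]

theorem abs_srwKernel_pow_le (N : ℕ) [NeZero N] (t : ℕ) (i j : Torus N) :
    |(srwKernel N ^ t) i j| ≤ 1 := by
  induction t generalizing i with
  | zero => rw [pow_zero, Matrix.one_apply]; split_ifs <;> simp
  | succ t ih =>
    rw [pow_succ', Matrix.mul_apply]
    calc _ ≤ ∑ k, |srwKernel N i k * (srwKernel N ^ t) k j| := Finset.abs_sum_le_sum_abs _ _
      _ ≤ ∑ k, srwKernel N i k := by
        refine Finset.sum_le_sum fun k _ => ?_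
        rw [abs_mul, abs_of_nonneg (srwKernel_nonneg N i k)]
        exact mul_le_of_le_one_right (srwKernel_nonneg N i k) (ih k)
      _ = 1 := sum_srwKernel N i

theorem green_symm (N : ℕ) [NeZero N] (i j : Torus N) : green N i j = green N j i := by
  unfold green
  congr! 6 with lam t
  rw [← Matrix.transpose_apply (srwKernel N ^ t) i j, Matrix.transpose_pow, srwKernel_transpose]

theorem green_add (N : ℕ) [NeZero N] (a i j : Torus N) :
    green N (i + a) (j + a) = green N i j := by
  simp only [green, srwKernel_pow_add]

theorem green_self (N : ℕ) [NeZero N] (i j : Torus N) : green N i i = green N j j := by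
  simpa using green_add N (i - j) j j

/-- The orthogonal projection onto the constants, as a matrix. -/
noncomputable def meanMatrix (N : ℕ) : Matrix (Torus N) (Torus N) ℝ := fun _ _ => 1 / (N ^ 2 : ℝ)

theorem sum_meanMatrix (N : ℕ) [NeZero N] : ∑ _i : Torus N, 1 / (N ^ 2 : ℝ) = 1 := by
  have : (N : ℝ) ≠ 0 := Nat.cast_ne_zero.2 (NeZero.ne N)
  rw [Finset.sum_const, Finset.card_univ, Fintype.card_prod, ZMod.card, nsmul_eq_mul]
  push_cast
  field_simp

theorem meanMatrix_mul_self (N : ℕ) [NeZero N] : meanMatrix N * meanMatrix N = meanMatrix N := by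
  ext i j
  simp only [Matrix.mul_apply, meanMatrix]
  rw [← Finset.sum_mul, sum_meanMatrix, one_mul]

theorem srwKernel_mul_meanMatrix (N : ℕ) [NeZero N] :
    srwKernel N * meanMatrix N = meanMatrix N := by
  ext i j
  simp only [Matrix.mul_apply, meanMatrix]
  rw [← Finset.sum_mul, sum_srwKernel, one_mul]

theorem meanMatrix_mul_srwKernel (N : ℕ) [NeZero N] :
    meanMatrix N * srwKernel N = meanMatrix N := by
  have h : (meanMatrix N).transpose = meanMatrix N := rfl
  rw [← h, ← srwKernel_transpose, ← Matrix.transpose_mul, srwKernel_mul_meanMatrix]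

theorem srwKernel_pow_mul_meanMatrix (N : ℕ) [NeZero N] (t : ℕ) :
    srwKernel N ^ t * meanMatrix N = meanMatrix N := by
  induction t with
  | zero => simp
  | succ t ih => rw [pow_succ, mul_assoc, srwKernel_mul_meanMatrix, ih]

/-- The Laplacian corrected on the constants is invertible. -/
theorem isUnit_det_one_sub_srwKernel_add (N : ℕ) [NeZero N] :
    IsUnit (1 - (1 : ℝ) • srwKernel N + meanMatrix N).det := by
  rw [isUnit_iff_ne_zero]
  intro h0
  obtain ⟨v, hv, hAv⟩ := Matrix.exists_mulVec_eq_zero_iff.2 h0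
  have hM : ∀ i, (meanMatrix N).mulVec v i = 1 / (N ^ 2 : ℝ) * ∑ j, v j := fun i => by
    simp [Matrix.mulVec, dotProduct, meanMatrix, Finset.mul_sum]
  have h1 : ∀ i, v i - (srwKernel N).mulVec v i + 1 / (N ^ 2 : ℝ) * ∑ j, v j = 0 := fun i => by
    have := congrFun hAv i
    rwa [one_smul, Matrix.add_mulVec, Matrix.sub_mulVec, Matrix.one_mulVec, Pi.add_apply,
      Pi.sub_apply, hM] at this
  have h2 := sum_grad_mul_grad N v v
  have h3 : ∑ i, v i * (v i - (srwKernel N).mulVec v i) = -(1 / (N ^ 2 : ℝ) * (∑ j, v j) ^ 2) := by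
    have : ∀ i, v i - (srwKernel N).mulVec v i = -(1 / (N ^ 2 : ℝ) * ∑ j, v j) := fun i => by
      linarith [h1 i]
    simp_rw [this]
    rw [← Finset.sum_mul]
    ring
  rw [h3] at h2
  have h4 : 0 ≤ 1 / (N ^ 2 : ℝ) * (∑ j, v j) ^ 2 := by positivity
  have h5 : ∑ e, grad v e * grad v e = 0 :=
    le_antisymm (by linarith) (Finset.sum_nonneg fun e _ => mul_self_nonneg _)
  have h6 : ∀ e, grad v e = 0 := fun e => mul_self_eq_zero.1
    ((Finset.sum_eq_zero_iff_of_nonneg fun e _ => mul_self_nonneg (grad v e)).1 h5 e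
      (Finset.mem_univ e))
  have h7 : ∀ i, v i = v 0 := fun i => eq_of_grad_eq_zero h6 i 0
  have h8 : ∑ j, v j = 0 := by
    have h9 : (0 : ℝ) < 1 / (N ^ 2 : ℝ) := by
      have := NeZero.pos N
      positivity
    rw [h5] at h2
    have : 1 / (N ^ 2 : ℝ) * (∑ j, v j) ^ 2 = 0 := by linarith
    exact pow_eq_zero_iff two_ne_zero |>.1 ((mul_eq_zero.1 this).resolve_left h9.ne')
  have h9 : v 0 = 0 := by
    simp_rw [h7] at h8
    simpa [NeZero.ne N] using h8
  exact hv (funext fun i => (h7 i).trans h9)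

/-- The generating function of the centred transition probabilities. -/
noncomputable def centredGen (N : ℕ) [NeZero N] (s : ℝ) : Matrix (Torus N) (Torus N) ℝ :=
  fun i j => ∑' t : ℕ, ((srwKernel N ^ t) i j - 1 / (N ^ 2 : ℝ)) * s ^ t

theorem summable_centredGen (N : ℕ) [NeZero N] {s : ℝ} (hs : |s| < 1) (i j : Torus N) :
    Summable fun t : ℕ => ((srwKernel N ^ t) i j - 1 / (N ^ 2 : ℝ)) * s ^ t := by
  refine Summable.of_norm_bounded ((summable_geometric_of_lt_one (abs_nonneg s) hs).mul_left
    (1 + |1 / (N ^ 2 : ℝ)|)) fun t => ?_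
  rw [norm_mul, norm_pow, Real.norm_eq_abs, Real.norm_eq_abs]
  gcongr
  exact (abs_sub _ _).trans (add_le_add_left (abs_srwKernel_pow_le N t i j) _)

theorem centredGen_mul (N : ℕ) [NeZero N] {s : ℝ} (hs : |s| < 1) :
    centredGen N s * (1 - s • srwKernel N + meanMatrix N) = 1 - meanMatrix N := by
  have h1 : centredGen N s = 1 - meanMatrix N + s • (centredGen N s * srwKernel N) := by
    ext i j
    rw [Matrix.add_apply, Matrix.smul_apply, Matrix.mul_apply]
    simp only [centredGen]
    rw [(summable_centredGen N hs i j).tsum_eq_zero_add]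
    congr 1
    · simp [meanMatrix]
    · simp_rw [← tsum_mul_right]
      rw [← Summable.tsum_finsetSum fun k _ => (summable_centredGen N hs i k).mul_right _,
        smul_eq_mul, ← tsum_mul_left]
      refine tsum_congr fun t => ?_
      have h := congrFun₂ (meanMatrix_mul_srwKernel N) i j
      simp only [Matrix.mul_apply, meanMatrix] at h
      rw [pow_succ (srwKernel N), Matrix.mul_apply]
      nth_rw 1 [← h]
      rw [← Finset.sum_sub_distrib, Finset.sum_mul, Finset.mul_sum]
      exact Finset.sum_congr rfl fun k _ => by ring
  have h2 : centredGen N s * meanMatrix N = 0 := by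
    ext i j
    rw [Matrix.mul_apply]
    simp only [centredGen, meanMatrix]
    rw [← Finset.sum_mul, ← Summable.tsum_finsetSum fun k _ => summable_centredGen N hs i k]
    have h3 : ∀ t : ℕ, ∑ k, ((srwKernel N ^ t) i k - 1 / (N ^ 2 : ℝ)) * s ^ t = 0 := by
      intro t
      have h := congrFun₂ (srwKernel_pow_mul_meanMatrix N t) i 0
      simp only [Matrix.mul_apply, meanMatrix] at h
      have h9 : (1 / (N ^ 2 : ℝ)) ≠ 0 := by
        have := NeZero.pos N
        positivity
      rw [← Finset.sum_mul, mul_eq_right₀ h9] at h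
      rw [← Finset.sum_mul, Finset.sum_sub_distrib, h, sum_meanMatrix, sub_self, zero_mul]
    rw [tsum_congr h3, tsum_zero, zero_mul, Matrix.zero_apply]
  rw [mul_add, mul_sub, h2, mul_one, add_zero, Matrix.mul_smul]
  nth_rw 1 [h1]
  simp

theorem tendsto_centredGen (N : ℕ) [NeZero N] :
    Tendsto (centredGen N) (nhdsWithin 1 (Set.Ioo 0 1))
      (nhds ((1 - meanMatrix N) * (1 - (1 : ℝ) • srwKernel N + meanMatrix N)⁻¹)) := by
  set A : ℝ → Matrix (Torus N) (Torus N) ℝ := fun s => 1 - s • srwKernel N + meanMatrix N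
  have hA : Continuous A := by fun_prop
  have hdet : Continuous fun s => (A s).det := hA.matrix_det
  have h1 : (A 1).det ≠ 0 := (isUnit_det_one_sub_srwKernel_add N).ne_zero
  have hlim : Tendsto (fun s => (1 - meanMatrix N) * (A s)⁻¹) (nhds 1)
      (nhds ((1 - meanMatrix N) * (A 1)⁻¹)) := by
    simp_rw [Matrix.inv_def, Ring.inverse_eq_inv']
    refine Tendsto.const_mul _ ?_
    exact ((hdet.tendsto 1).inv₀ h1).smul (hA.matrix_adjugate.tendsto 1)
  refine (hlim.mono_left nhdsWithin_le_nhds).congr' ?_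
  filter_upwards [self_mem_nhdsWithin, nhdsWithin_le_nhds ((hdet.tendsto 1).eventually_ne h1)]
    with s hs hs1
  rw [← centredGen_mul N (abs_lt.2 ⟨by linarith [hs.1], hs.2⟩), mul_assoc,
    Matrix.mul_nonsing_inv _ (isUnit_iff_ne_zero.2 hs1), mul_one]

theorem green_eq (N : ℕ) [NeZero N] (i j : Torus N) :
    green N i j = ((1 - meanMatrix N) * (1 - (1 : ℝ) • srwKernel N + meanMatrix N)⁻¹) i j := by
  refine Tendsto.limUnder_eq ?_
  have h1 : Tendsto (fun lam : ℝ => Real.exp (-lam)) (nhdsWithin 0 (Set.Ioi 0))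
      (nhdsWithin 1 (Set.Ioo 0 1)) := by
    refine tendsto_nhdsWithin_iff.2 ⟨?_, ?_⟩
    · have : Continuous fun lam : ℝ => Real.exp (-lam) := by fun_prop
      simpa using (this.tendsto 0).mono_left nhdsWithin_le_nhds
    · filter_upwards [self_mem_nhdsWithin] with lam hlam
      exact ⟨Real.exp_pos _, by simpa using hlam⟩
  have h2 := ((tendsto_pi_nhds.1 (tendsto_pi_nhds.1 (tendsto_centredGen N) i) j)).comp h1
  refine h2.congr fun lam => ?_
  simp only [Function.comp_apply, centredGen]
  refine tsum_congr fun t => ?_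
  rw [← Real.exp_nat_mul, mul_comm (t : ℝ)]

theorem green_mul (N : ℕ) [NeZero N] :
    Matrix.of (green N) * (1 - srwKernel N + meanMatrix N) = 1 - meanMatrix N := by
  have h : Matrix.of (green N) =
      (1 - meanMatrix N) * (1 - (1 : ℝ) • srwKernel N + meanMatrix N)⁻¹ := by
    ext i j
    exact green_eq N i j
  rw [h, mul_assoc]
  nth_rw 2 [← one_smul ℝ (srwKernel N)]
  rw [Matrix.nonsing_inv_mul _ (isUnit_det_one_sub_srwKernel_add N), mul_one]

theorem green_sub_mulVec (N : ℕ) [NeZero N] (i l : Torus N) :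
    green N i l - (srwKernel N).mulVec (green N i) l =
      (if i = l then 1 else 0) - 1 / (N ^ 2 : ℝ) := by
  have h1 : Matrix.of (green N) * meanMatrix N = 0 := by
    have h := congrArg (· * meanMatrix N) (green_mul N)
    simpa [mul_assoc, add_mul, sub_mul, srwKernel_mul_meanMatrix, meanMatrix_mul_self] using h
  have h2 := green_mul N
  rw [mul_add, h1, add_zero, mul_sub, mul_one] at h2
  have h3 := congrFun₂ h2 i l
  rw [Matrix.sub_apply, Matrix.sub_apply, Matrix.mul_apply, Matrix.one_apply] at h3
  simp only [Matrix.of_apply, meanMatrix] at h3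
  rw [← h3, Matrix.mulVec, dotProduct]
  congr 1
  refine Finset.sum_congr rfl fun k _ => ?_
  rw [← srwKernel_transpose, Matrix.transpose_apply, srwKernel_transpose, mul_comm]

/-- The Green's function inverts the Dirichlet form on functions modulo constants. -/
theorem sum_grad_mul_grad_sum_green (N : ℕ) [NeZero N] (f k : Torus N → ℝ)
    (hk : ∑ a, k a = 0) :
    ∑ e, grad f e * grad (fun l => ∑ a, k a * green N a l) e = 4 * ∑ a, k a * f a := by
  rw [sum_grad_mul_grad]
  congr 1
  refine Finset.sum_congr rfl fun v _ => ?_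
  have h : (srwKernel N).mulVec (fun l => ∑ a, k a * green N a l) v =
      ∑ a, k a * (srwKernel N).mulVec (green N a) v := by
    simp only [Matrix.mulVec, dotProduct, Finset.mul_sum]
    rw [Finset.sum_comm]
    exact Finset.sum_congr rfl fun a _ => Finset.sum_congr rfl fun b _ => by ring
  rw [h, ← Finset.sum_sub_distrib]
  simp_rw [← mul_sub, green_sub_mulVec]
  simp [mul_sub, Finset.sum_sub_distrib, ← Finset.sum_mul, hk, mul_comm]

theorem pin_sub_zero {N : ℕ} (f : Torus N → ℝ) (v : Torus N) :
    pin (fun s : {v : Torus N // v ≠ 0} => f s - f 0) v = f v - f 0 := by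
  unfold pin; split_ifs with h <;> simp [h]

theorem pin_intCast {N : ℕ} (x : {v : Torus N // v ≠ 0} → ℤ) (v : Torus N) :
    pin (fun s => (x s : ℝ)) v = (pin x v : ℤ) := by
  unfold pin; split_ifs <;> simp

/-- A multiple of the discrete gradient, as a linear map on the functions pinned at the origin. -/
noncomputable def pinGrad (N : ℕ) (c : ℝ) :
    ({v : Torus N // v ≠ 0} → ℝ) →ₗ[ℝ] EuclideanSpace ℝ (TorusEdge N) where
  toFun y := WithLp.toLp 2 fun e => c * grad (pin y) e
  map_add' x y := by
    ext e
    simp only [grad, pin, PiLp.add_apply, Pi.add_apply]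
    split_ifs <;> ring
  map_smul' a y := by
    ext e
    simp only [grad, pin, PiLp.smul_apply, Pi.smul_apply, smul_eq_mul, RingHom.id_apply]
    split_ifs <;> ring

theorem inner_pinGrad (N : ℕ) [NeZero N] (c : ℝ) (x y : {v : Torus N // v ≠ 0} → ℝ) :
    inner ℝ (pinGrad N c x) (pinGrad N c y) = c ^ 2 * ∑ e, grad (pin y) e * grad (pin x) e := by
  rw [PiLp.inner_apply, Finset.mul_sum]
  refine Finset.sum_congr rfl fun e _ => ?_
  simp [pinGrad]
  ring

theorem pinGrad_injective (N : ℕ) [NeZero N] {c : ℝ} (hc : c ≠ 0) :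
    Function.Injective (pinGrad N c) := by
  rw [← LinearMap.ker_eq_bot, LinearMap.ker_eq_bot']
  intro y hy
  have h : ∀ e, grad (pin y) e = 0 := fun e => by
    have := congrArg (fun z : EuclideanSpace ℝ (TorusEdge N) => z e) hy
    simpa [pinGrad, hc] using this
  funext s
  have := eq_of_grad_eq_zero h s.1 0
  simpa [pin, s.2] using this

theorem norm_pinGrad_sq (N : ℕ) [NeZero N] (c : ℝ) (x : {v : Torus N // v ≠ 0} → ℤ) :
    ‖pinGrad N c fun s => (x s : ℝ)‖ ^ 2 = c ^ 2 * energy (pin x) := by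
  rw [← real_inner_self_eq_norm_sq, inner_pinGrad, energy]
  push_cast
  congr 1
  refine Finset.sum_congr rfl fun e _ => ?_
  simp only [grad, pin_intCast]
  push_cast
  ring

/-- The neutral charge configuration with prescribed values, in units of `2π`, off the origin. -/
noncomputable def charge {N : ℕ} [NeZero N] (m : {v : Torus N // v ≠ 0} → ℝ) (l : Torus N) : ℝ :=
  if hl : l = 0 then -(2 * Real.pi) * ∑ s, m s else 2 * Real.pi * m ⟨l, hl⟩

theorem sum_charge_mul {N : ℕ} [NeZero N] (m : {v : Torus N // v ≠ 0} → ℝ) (f : Torus N → ℝ) :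
    ∑ l, charge m l * f l = 2 * Real.pi * ∑ s, m s * (f s - f 0) := by
  rw [Fintype.sum_eq_add_sum_subtype_ne _ (0 : Torus N), Finset.mul_sum]
  have h : ∀ s : {v : Torus N // v ≠ 0}, charge m s * f s = 2 * Real.pi * m s * f s := fun s => by
    simp [charge, s.2]
  simp_rw [h, charge, dif_pos, mul_sub, Finset.sum_sub_distrib, ← mul_assoc, ← Finset.sum_mul,
    ← Finset.mul_sum]
  ring

theorem sum_charge {N : ℕ} [NeZero N] (m : {v : Torus N // v ≠ 0} → ℝ) : ∑ l, charge m l = 0 := by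
  simpa using sum_charge_mul m fun _ => 1

/-- The potential of a charge configuration. -/
noncomputable def potential {N : ℕ} [NeZero N] (m : {v : Torus N // v ≠ 0} → ℝ) (l : Torus N) : ℝ :=
  ∑ a, charge m a * green N a l

/-- A multiple of the potential, normalized to vanish at the origin. -/
noncomputable def pinPotential (N : ℕ) [NeZero N] (c : ℝ) :
    ({v : Torus N // v ≠ 0} → ℝ) →ₗ[ℝ] {v : Torus N // v ≠ 0} → ℝ where
  toFun m s := c * potential m s - c * potential m 0
  map_add' x y := by
    funext s
    simp only [potential, sum_charge_mul, Pi.add_apply, add_mul, Finset.sum_add_distrib]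
    ring
  map_smul' a y := by
    funext s
    simp only [potential, sum_charge_mul, Pi.smul_apply, smul_eq_mul, mul_assoc, ← Finset.mul_sum,
      RingHom.id_apply]
    ring

theorem grad_pinPotential (N : ℕ) [NeZero N] (c : ℝ) (m : {v : Torus N // v ≠ 0} → ℝ)
    (e : TorusEdge N) : grad (pin (pinPotential N c m)) e = c * grad (potential m) e := by
  have h : ∀ v, pin (pinPotential N c m) v = c * potential m v - c * potential m 0 := fun v =>
    pin_sub_zero (fun l => c * potential m l) v
  simp only [grad, h]
  ring

theorem inner_pinGrad_pinPotential (N : ℕ) [NeZero N] {c d : ℝ} (h : 8 * (c ^ 2 * d) = 1)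
    (m y : {v : Torus N // v ≠ 0} → ℝ) :
    inner ℝ (pinGrad N c (pinPotential N d m)) (pinGrad N c y) = Real.pi * ∑ s, m s * y s := by
  rw [inner_pinGrad]
  simp_rw [grad_pinPotential, mul_left_comm _ d]
  rw [← Finset.mul_sum]
  have h1 := sum_grad_mul_grad_sum_green N (pin y) (charge m) (sum_charge m)
  have h2 : ∑ s, m s * (pin y s - pin y 0) = ∑ s, m s * y s :=
    Finset.sum_congr rfl fun s _ => by simp [pin, s.2]
  rw [sum_charge_mul, h2] at h1
  change c ^ 2 * (d * ∑ e, grad (pin y) e * grad (fun l => ∑ a, charge m a * green N a l) e) = _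
  rw [h1]
  linear_combination (Real.pi * ∑ s, m s * y s) * h

theorem norm_pinGrad_pinPotential_sq (N : ℕ) [NeZero N] {c d : ℝ} (h : 8 * (c ^ 2 * d) = 1)
    (m : {v : Torus N // v ≠ 0} → ℝ) :
    ‖pinGrad N c (pinPotential N d m)‖ ^ 2 =
      d / 2 * ∑ a, ∑ b, charge m a * green N a b * charge m b := by
  rw [← real_inner_self_eq_norm_sq, inner_pinGrad_pinPotential N h, Finset.sum_comm]
  simp_rw [← Finset.sum_mul]
  have h1 := sum_charge_mul m (potential m)
  simp_rw [mul_comm (charge m _) (potential m _)] at h1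
  change _ = d / 2 * ∑ b, potential m b * charge m b
  rw [h1]
  have h2 : ∀ s, m s * pinPotential N d m s = d * (m s * (potential m s - potential m 0)) :=
    fun s => by
      change m s * (d * potential m s - d * potential m 0) = _
      ring
  simp_rw [h2]
  rw [← Finset.mul_sum]
  ring

/-- The difference of two Green's functions, normalized to vanish at the origin. -/
noncomputable def pinDipole {N : ℕ} [NeZero N] (i j : Torus N) (s : {v : Torus N // v ≠ 0}) : ℝ :=
  (green N i s - green N j s) - (green N i 0 - green N j 0)

theorem inner_pinGrad_pinDipole (N : ℕ) [NeZero N] (c : ℝ) (i j : Torus N)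
    (y : {v : Torus N // v ≠ 0} → ℝ) :
    inner ℝ (pinGrad N c (pinDipole i j)) (pinGrad N c y) = 4 * c ^ 2 * (pin y i - pin y j) := by
  have h1 := sum_grad_mul_grad_sum_green N (pin y) (Pi.single i 1 - Pi.single j 1)
    (by simp [Finset.sum_sub_distrib])
  simp only [Pi.sub_apply, sub_mul, Finset.sum_sub_distrib, Pi.single_apply, ite_mul, one_mul,
    zero_mul, Finset.sum_ite_eq', Finset.mem_univ, if_true] at h1
  have h2 : ∀ v, pin (pinDipole i j) v =
      (green N i v - green N j v) - (green N i 0 - green N j 0) := fun v =>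
    pin_sub_zero (fun l => green N i l - green N j l) v
  have h3 : ∀ e, grad (pin (pinDipole i j)) e = grad (fun l => green N i l - green N j l) e :=
    fun e => by simp only [grad, h2]; ring
  rw [inner_pinGrad]
  simp_rw [h3]
  rw [h1]
  ring

theorem norm_pinGrad_pinDipole_sq (N : ℕ) [NeZero N] (c : ℝ) (i j : Torus N) :
    ‖pinGrad N c (pinDipole i j)‖ ^ 2 = 8 * c ^ 2 * (green N i i - green N i j) := by
  have h2 : ∀ v, pin (pinDipole i j) v =
      (green N i v - green N j v) - (green N i 0 - green N j 0) := fun v =>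
    pin_sub_zero (fun l => green N i l - green N j l) v
  rw [← real_inner_self_eq_norm_sq, inner_pinGrad_pinDipole, h2, h2, green_symm N j i,
    green_self N j i]
  ring

/-- Variance of voltages in the lattice Coulomb gas on an `N × N` torus (`N ≥ 4`) at
inverse temperature `β* ≤ 1/12`. The Coulomb gas configurations are
`k ∈ Ω*_Λ = 2πℤ^Λ ∩ {∑ k_i = 0}`, parametrized by their values on `Λ∖{0}`, with Gibbs
weights `e^{−(β*/4) kᵀGk}`; the voltage is `U_{ij}(k) = ∑_ℓ (G_{iℓ} − G_{jℓ}) k_ℓ`.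
Then `E*[U_{ij}] = 0`, so `Var* U_{ij} = E*[U_{ij}²]`, and
`(4/β*)(G_{ii} − G_{ij}) − (4/(β*)²) M_{(4β*)⁻¹} ≤ E*[U_{ij}²] ≤ (4/β*)(G_{ii} − G_{ij})`,
where `M_β = 2φ(β)(1+φ(β))/(1−φ(β))³` and `φ(β) = 480(3e^{−β})⁴`. -/
theorem stmt19 (N : ℕ) [NeZero N] (hN : 4 ≤ N) (βs : ℝ) (hβs0 : 0 < βs)
    (hβs : βs ≤ 1 / 12) (i j : Torus N) :
    let φ : ℝ → ℝ := fun b => 480 * (3 * Real.exp (-b)) ^ 4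
    let M : ℝ → ℝ := fun b => 2 * φ b * (1 + φ b) / (1 - φ b) ^ 3
    let kvec : ({v : Torus N // v ≠ 0} → ℤ) → Torus N → ℝ := fun m l =>
      if hl : l = 0 then -(2 * Real.pi) * ∑ s, (m s : ℝ) else 2 * Real.pi * (m ⟨l, hl⟩ : ℝ)
    let w : ({v : Torus N // v ≠ 0} → ℤ) → ℝ := fun m =>
      Real.exp (-(βs / 4) * ∑ a : Torus N, ∑ b : Torus N, kvec m a * green N a b * kvec m b)
    let U : ({v : Torus N // v ≠ 0} → ℤ) → ℝ := fun m =>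
      ∑ l : Torus N, (green N i l - green N j l) * kvec m l
    let Z : ℝ := ∑' m, w m
    (∑' m, U m * w m) / Z = 0 ∧
    4 / βs * (green N i i - green N i j) - 4 / βs ^ 2 * M (4 * βs)⁻¹
        ≤ (∑' m, U m ^ 2 * w m) / Z ∧
    (∑' m, U m ^ 2 * w m) / Z ≤ 4 / βs * (green N i i - green N i j) := by
  intro φ M kvec w U Z
  set β : ℝ := (4 * βs)⁻¹ with hβdef
  have hβ3 : 3 ≤ β := by
    rw [hβdef, le_inv_comm₀ (by norm_num) (by positivity)]
    linarith
  have hβ0 : 0 < β := by positivity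
  have hc2 : Real.sqrt β ^ 2 = β := Real.sq_sqrt hβ0.le
  have hcd : 8 * (Real.sqrt β ^ 2 * (βs / 2)) = 1 := by
    rw [hc2, hβdef]
    field_simp
    norm_num
  have hT := pinGrad_injective N (Real.sqrt_pos.2 hβ0).ne'
  have hw : ∀ m, w m = Real.exp (-‖pinGrad N (Real.sqrt β)
      (pinPotential N (βs / 2) fun s => (m s : ℝ))‖ ^ 2) := by
    intro m
    rw [norm_pinGrad_pinPotential_sq N hcd]
    change Real.exp (-(βs / 4) * ∑ a, ∑ b, charge (fun s => (m s : ℝ)) a * green N a b *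
      charge (fun s => (m s : ℝ)) b) = _
    congr 1
    ring
  have hU : ∀ m, U m = 2 * Real.pi * ∑ s, (m s : ℝ) * pinDipole i j s := by
    intro m
    have h := sum_charge_mul (fun s => (m s : ℝ)) fun l => green N i l - green N j l
    change _ = 2 * Real.pi * ∑ s : {v : Torus N // v ≠ 0}, (m s : ℝ) *
      ((green N i s - green N j s) - (green N i 0 - green N j 0))
    rw [← h]
    exact Finset.sum_congr rfl fun l _ => mul_comm _ _
  have hW : ∀ x : {v : Torus N // v ≠ 0} → ℤ,
      Real.exp (-‖pinGrad N (Real.sqrt β) fun s => (x s : ℝ)‖ ^ 2) = gaussWeight β x := by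
    intro x
    rw [norm_pinGrad_sq, hc2, gaussWeight, neg_mul]
  have hD : ∀ x : {v : Torus N // v ≠ 0} → ℤ, inner ℝ (pinGrad N (Real.sqrt β) (pinDipole i j))
      (pinGrad N (Real.sqrt β) fun s => (x s : ℝ)) = 4 * β * heightDiff i j x := by
    intro x
    rw [inner_pinGrad_pinDipole, hc2, pin_intCast, pin_intCast, heightDiff]
    push_cast
    ring
  have hs0 : Summable fun x : {v : Torus N // v ≠ 0} → ℤ => gaussWeight β x := by
    simpa [hW] using summable_exp_neg_norm_sq_add _ hT 0
  have hs2 : Summable fun x : {v : Torus N // v ≠ 0} → ℤ =>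
      (heightDiff i j x : ℝ) ^ 2 * gaussWeight β x := by
    have h := summable_sq_mul_gauss _ hT
      (innerₗ _ (pinGrad N (Real.sqrt β) (pinDipole i j)) ∘ₗ pinGrad N (Real.sqrt β))
    simp only [LinearMap.comp_apply, innerₗ_apply_apply, hD, hW, mul_pow, mul_assoc] at h
    simpa [summable_mul_left_iff, hβ0.ne'] using h
  have hZ0 : 0 < ∑' x : {v : Torus N // v ≠ 0} → ℤ, gaussWeight β x :=
    hs0.tsum_pos (fun x => (Real.exp_pos _).le) 0 (Real.exp_pos _)
  have hdual := gauss_duality_second_moment _ hT _ (inner_pinGrad_pinPotential N hcd)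
    (pinDipole i j)
  simp only [← hw, ← hU, hW, hD, norm_pinGrad_pinDipole_sq, hc2, mul_pow, mul_assoc] at hdual
  rw [tsum_mul_left, tsum_mul_left] at hdual
  set V : ℝ := (∑' x : {v : Torus N // v ≠ 0} → ℤ, (heightDiff i j x : ℝ) ^ 2 * gaussWeight β x) /
    ∑' x : {v : Torus N // v ≠ 0} → ℤ, gaussWeight β x with hV
  have hval : (∑' m, U m ^ 2 * w m) / Z =
      4 / βs * (green N i i - green N i j) - 4 / βs ^ 2 * V := by
    rw [hdual, mul_div_assoc, mul_div_assoc, ← hV, hβdef]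
    field_simp
    ring
  have hV0 : 0 ≤ V := div_nonneg
    (tsum_nonneg fun x => mul_nonneg (sq_nonneg _) (Real.exp_pos _).le) hZ0.le
  have hVM : V ≤ M β :=
    (div_le_iff₀ hZ0).2 (tsum_heightDiff_sq_le (by omega) hβ3 i j hs0 hs2 rfl)
  refine ⟨?_, ?_, ?_⟩
  · have hneg : ∀ m, U (-m) * w (-m) = -(U m * w m) := by
      intro m
      have h : (fun s => ((-m) s : ℝ)) = -fun s => (m s : ℝ) := by
        funext s
        simp
      rw [hU, hU, hw, hw, h, map_neg, map_neg, norm_neg]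
      simp
    have h := (Equiv.neg ({v : Torus N // v ≠ 0} → ℤ)).tsum_eq fun m => U m * w m
    simp only [Equiv.neg_apply, hneg, tsum_neg] at h
    rw [show ∑' m, U m * w m = 0 by linarith, zero_div]
  · rw [hval]
    gcongr
  · rw [hval]
    have : 0 ≤ 4 / βs ^ 2 * V := by positivity
    linarith
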